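/- arXiv:1801.08477 — 18 statements merged into one kernel-verified Lean document; each statement's English description precedes it below -/
import Mathlib

section
/- Let f : [0,∞) → [0,∞) be wide-sense increasing. Then f↓ = (f⁺)↓ and f↑ = (f⁻)↑, i.e., the lower pseudo-inverse of f equals the lower pseudo-inverse of its right-limit function, and the upper pseudo-inverse of f equals the upper pseudo-inverse of its left-limit function. -/
open scoped NNReal ENNReal

/-- Lower pseudo-inverse `f↓(x) = inf{s ≥ 0 : f(s) ≥ x}`, with `inf ∅ = +∞`. -/
noncomputable def lowerPseudoInv (f : ℝ≥0 → ℝ≥0) (x : ℝ≥0) : ℝ≥0∞ :=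
  ⨅ s : {s : ℝ≥0 // x ≤ f s}, ((s : ℝ≥0) : ℝ≥0∞)

/-- Upper pseudo-inverse `f↑(x) = sup{s ≥ 0 : f(s) ≤ x}`, with `sup ∅ = 0`. -/
noncomputable def upperPseudoInv (f : ℝ≥0 → ℝ≥0) (x : ℝ≥0) : ℝ≥0∞ :=
  ⨆ s : {s : ℝ≥0 // f s ≤ x}, ((s : ℝ≥0) : ℝ≥0∞)

/-- Right-limit function `f⁺(t) = inf_{s > t} f(s)`. -/
noncomputable def rightLim' (f : ℝ≥0 → ℝ≥0) (t : ℝ≥0) : ℝ≥0 :=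
  ⨅ s : {s : ℝ≥0 // t < s}, f (s : ℝ≥0)

/-- Left-limit function `f⁻(t) = sup_{0 ≤ s < t} f(s)` (with `f⁻(0) = 0`). -/
noncomputable def leftLim' (f : ℝ≥0 → ℝ≥0) (t : ℝ≥0) : ℝ≥0 :=
  ⨆ s : {s : ℝ≥0 // s < t}, f (s : ℝ≥0)

theorem aux_le_right (f : ℝ≥0 → ℝ≥0) (hf : Monotone f) (s : ℝ≥0) : f s ≤ rightLim' f s := by
  haveI : Nonempty {r : ℝ≥0 // s < r} := ⟨⟨s + 1, lt_add_one s⟩⟩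
  exact le_ciInf fun r => hf r.2.le

theorem aux_right_le (f : ℝ≥0 → ℝ≥0) (s t : ℝ≥0) (h : s < t) : rightLim' f s ≤ f t :=
  ciInf_le (f := fun r : {r : ℝ≥0 // s < r} => f r) (OrderBot.bddBelow _) ⟨t, h⟩

theorem aux_left_le (f : ℝ≥0 → ℝ≥0) (hf : Monotone f) (t : ℝ≥0) : leftLim' f t ≤ f t :=
  ciSup_le' fun r => hf r.2.le

theorem aux_le_left (f : ℝ≥0 → ℝ≥0) (hf : Monotone f) (s t : ℝ≥0) (h : s < t) :
    f s ≤ leftLim' f t :=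
  le_ciSup (f := fun r : {r : ℝ≥0 // r < t} => f r)
    ⟨f t, by rintro _ ⟨r, rfl⟩; exact hf r.2.le⟩ ⟨s, h⟩

/-- for wide-sense increasing `f`, `f↓ = (f⁺)↓` and `f↑ = (f⁻)↑`. -/
theorem pseudoInv_of_limits (f : ℝ≥0 → ℝ≥0) (hf : Monotone f) :
    lowerPseudoInv f = lowerPseudoInv (rightLim' f) ∧
    upperPseudoInv f = upperPseudoInv (leftLim' f) := by
  constructor
  · funext x
    apply le_antisymm
    · refine le_iInf fun s => ?_
      refine le_of_forall_gt_imp_ge_of_dense fun b hb => ?_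
      obtain ⟨r, hr1, hr2⟩ := ENNReal.lt_iff_exists_nnreal_btwn.1 hb
      have h : x ≤ f r := s.2.trans (aux_right_le f _ _ (ENNReal.coe_lt_coe.1 hr1))
      exact (iInf_le (fun s : {s : ℝ≥0 // x ≤ f s} => ((s : ℝ≥0) : ℝ≥0∞)) ⟨r, h⟩).trans hr2.le
    · refine le_iInf fun s => ?_
      exact iInf_le (fun s : {s : ℝ≥0 // x ≤ rightLim' f s} => ((s : ℝ≥0) : ℝ≥0∞))
        ⟨s, s.2.trans (aux_le_right f hf s)⟩
  · funext x
    apply le_antisymm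
    · refine iSup_le fun s => ?_
      exact le_iSup (fun s : {s : ℝ≥0 // leftLim' f s ≤ x} => ((s : ℝ≥0) : ℝ≥0∞))
        ⟨s, (aux_left_le f hf s).trans s.2⟩
    · refine iSup_le fun s => ?_
      refine le_of_forall_lt_imp_le_of_dense fun b hb => ?_
      obtain ⟨r, hr1, hr2⟩ := ENNReal.lt_iff_exists_nnreal_btwn.1 hb
      have h : f r ≤ x := (aux_le_left f hf _ _ (ENNReal.coe_lt_coe.1 hr2)).trans s.2
      exact hr1.le.trans (le_iSup (fun s : {s : ℝ≥0 // f s ≤ x} => ((s : ℝ≥0) : ℝ≥0∞)) ⟨r, h⟩)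
end

section
/- Let f : [0,∞) → [0,∞) be wide-sense increasing. Then (f↑)⁻ = f↓ and (f↓)⁺ = f↑, i.e., the left-limit function of the upper pseudo-inverse of f equals the lower pseudo-inverse of f, and the right-limit function of the lower pseudo-inverse of f equals the upper pseudo-inverse of f. -/
open scoped NNReal ENNReal

/-- Right-limit function `g⁺(x) = inf_{y > x} g(y)` of a `[0,∞]`-valued function. -/
noncomputable def rightLimE (g : ℝ≥0 → ℝ≥0∞) (x : ℝ≥0) : ℝ≥0∞ :=
  ⨅ y : {y : ℝ≥0 // x < y}, g (y : ℝ≥0)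

/-- Left-limit function `g⁻(x) = sup_{0 ≤ y < x} g(y)` (with `g⁻(0) = 0`)
of a `[0,∞]`-valued function. -/
noncomputable def leftLimE (g : ℝ≥0 → ℝ≥0∞) (x : ℝ≥0) : ℝ≥0∞ :=
  ⨆ y : {y : ℝ≥0 // y < x}, g (y : ℝ≥0)

/-- for wide-sense increasing `f`, `(f↑)⁻ = f↓` and `(f↓)⁺ = f↑`. -/
theorem limits_of_pseudoInv (f : ℝ≥0 → ℝ≥0) (hf : Monotone f) :
    leftLimE (upperPseudoInv f) = lowerPseudoInv f ∧
    rightLimE (lowerPseudoInv f) = upperPseudoInv f := by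
  constructor
  · funext x
    apply le_antisymm
    · refine iSup_le fun y => iSup_le fun s => le_iInf fun t => ?_
      have h : f s.1 < f t.1 := lt_of_le_of_lt s.2 (lt_of_lt_of_le y.2 t.2)
      exact ENNReal.coe_le_coe.2 (hf.reflect_lt h).le
    · by_contra hc
      obtain ⟨r, h1, h2⟩ := ENNReal.lt_iff_exists_nnreal_btwn.1 (not_le.1 hc)
      have hr : f r < x := by
        by_contra h
        exact absurd h2 (not_lt.2 (iInf_le (fun s : {s : ℝ≥0 // x ≤ f s} =>
          ((s : ℝ≥0) : ℝ≥0∞)) ⟨r, not_lt.1 h⟩))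
      have a : (r : ℝ≥0∞) ≤ upperPseudoInv f (f r) :=
        le_iSup (fun s : {s : ℝ≥0 // f s ≤ f r} => ((s : ℝ≥0) : ℝ≥0∞)) ⟨r, le_rfl⟩
      have b : upperPseudoInv f (f r) ≤ leftLimE (upperPseudoInv f) x :=
        le_iSup (fun y : {y : ℝ≥0 // y < x} => upperPseudoInv f (y : ℝ≥0)) ⟨f r, hr⟩
      exact absurd h1 (not_lt.2 (a.trans b))
  · funext x
    apply le_antisymm
    · by_contra hc
      obtain ⟨r, h1, h2⟩ := ENNReal.lt_iff_exists_nnreal_btwn.1 (not_le.1 hc)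
      have hr : x < f r := by
        by_contra h
        exact absurd h1 (not_lt.2 (le_iSup (fun s : {s : ℝ≥0 // f s ≤ x} =>
          ((s : ℝ≥0) : ℝ≥0∞)) ⟨r, not_lt.1 h⟩))
      have a : lowerPseudoInv f (f r) ≤ (r : ℝ≥0∞) :=
        iInf_le (fun s : {s : ℝ≥0 // f r ≤ f s} => ((s : ℝ≥0) : ℝ≥0∞)) ⟨r, le_rfl⟩
      have b : rightLimE (lowerPseudoInv f) x ≤ lowerPseudoInv f (f r) :=
        iInf_le (fun y : {y : ℝ≥0 // x < y} => lowerPseudoInv f (y : ℝ≥0)) ⟨f r, hr⟩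
      exact absurd h2 (not_lt.2 (b.trans a))
    · refine le_iInf fun y => le_iInf fun t => iSup_le fun s => ?_
      have h : f s.1 < f t.1 := lt_of_le_of_lt s.2 (lt_of_lt_of_le y.2 t.2)
      exact ENNReal.coe_le_coe.2 (hf.reflect_lt h).le
end

section
/- Let (A, L) be a single-flow packet sequence with A : ℕ⁺ → [0,∞) wide-sense increasing and L : ℕ⁺ → ℕ⁺, let R be its cumulative arrival function, and let σ : [0,∞) → [0,∞) be wide-sense increasing. Then the following three conditions are equivalent: (1) the flow satisfies the arrival curve constraint σ, i.e., R(t) ≤ R(s) + σ(t−s) for all 0 ≤ s ≤ t; (2) for all m, n ∈ ℕ⁺ with m ≤ n: Σ_{j=m}^{n} L_j ≤ σ⁺(A_n − A_m); (3) for all m, n ∈ ℕ⁺ with m ≤ n: A_n − A_m ≥ σ↓(Σ_{j=m}^{n} L_j). -/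
open scoped NNReal ENNReal

/-- Cumulative arrival function `R(t) = Σ_{n} L_n · 1{A_n < t}`
(packets are indexed by `0, 1, 2, …`, i.e. packet `n+1` of the paper is packet `n`). -/
noncomputable def cumArrival (A : ℕ → ℝ≥0) (L : ℕ → ℕ+) (t : ℝ≥0) : ℝ≥0∞ :=
  ∑' n : ℕ, if A n < t then ((L n : ℕ) : ℝ≥0∞) else 0

theorem le_rightLim'_iff (σ : ℝ≥0 → ℝ≥0) (x d : ℝ≥0) :
    x ≤ rightLim' σ d ↔ ∀ u, d < u → x ≤ σ u := by
  unfold rightLim'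
  haveI : Nonempty {s : ℝ≥0 // d < s} := ⟨⟨d + 1, lt_add_of_pos_right d one_pos⟩⟩
  rw [le_ciInf_iff (OrderBot.bddBelow _)]
  exact ⟨fun h u hu => h ⟨u, hu⟩, fun h u => h u.1 u.2⟩

theorem lowerPseudoInv_le_iff (σ : ℝ≥0 → ℝ≥0) (hσ : Monotone σ) (x d : ℝ≥0) :
    lowerPseudoInv σ x ≤ (d : ℝ≥0∞) ↔ ∀ u, d < u → x ≤ σ u := by
  unfold lowerPseudoInv
  constructor
  · intro h u hu
    have h1 := lt_of_le_of_lt h (ENNReal.coe_lt_coe.2 hu)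
    obtain ⟨s, hs⟩ := iInf_lt_iff.1 h1
    exact s.2.trans (hσ (ENNReal.coe_lt_coe.1 hs).le)
  · intro h
    refine le_of_forall_gt fun c hc => ?_
    obtain ⟨u, hu1, hu2⟩ := ENNReal.lt_iff_exists_nnreal_btwn.1 hc
    exact (iInf_le (fun s : {s : ℝ≥0 // x ≤ σ s} => ((s : ℝ≥0) : ℝ≥0∞))
      ⟨u, h u (ENNReal.coe_lt_coe.1 hu1)⟩).trans_lt hu2

/-- equivalence of the arrival-curve constraint with the max-plus style
packet-time conditions via `σ⁺` and `σ↓`. -/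
theorem arrivalCurve_iff_packetTimes (A : ℕ → ℝ≥0) (L : ℕ → ℕ+) (hA : Monotone A)
    (σ : ℝ≥0 → ℝ≥0) (hσ : Monotone σ) :
    ((∀ s t : ℝ≥0, s ≤ t →
        cumArrival A L t ≤ cumArrival A L s + (σ (t - s) : ℝ≥0∞)) ↔
      (∀ m n : ℕ, m ≤ n →
        ((∑ j ∈ Finset.Icc m n, (L j : ℕ) : ℕ) : ℝ≥0) ≤ rightLim' σ (A n - A m))) ∧
    ((∀ m n : ℕ, m ≤ n →
        ((∑ j ∈ Finset.Icc m n, (L j : ℕ) : ℕ) : ℝ≥0) ≤ rightLim' σ (A n - A m)) ↔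
      (∀ m n : ℕ, m ≤ n →
        lowerPseudoInv σ ((∑ j ∈ Finset.Icc m n, (L j : ℕ) : ℕ) : ℝ≥0)
          ≤ ((A n - A m : ℝ≥0) : ℝ≥0∞))) := by
  simp only [le_rightLim'_iff, lowerPseudoInv_le_iff σ hσ, and_true]
  constructor
  · intro h m n hmn u hu
    have hut : A n < A m + u := by
      rw [add_comm]; exact (tsub_lt_iff_right (hA hmn)).1 hu
    have h1 := h (A m) (A m + u) le_self_add
    rw [add_tsub_cancel_left] at h1
    have hfin : cumArrival A L (A m) ≠ ⊤ := by
      unfold cumArrival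
      rw [tsum_eq_sum (s := Finset.range m)]
      · refine (ENNReal.sum_lt_top.2 fun k _ => ?_).ne
        split_ifs
        · exact ENNReal.natCast_lt_top _
        · simp
      · intro k hk
        rw [if_neg]
        exact not_lt.2 (hA (by simpa using hk))
    have h2 : cumArrival A L (A m) + ∑ j ∈ Finset.Icc m n, ((L j : ℕ) : ℝ≥0∞)
        ≤ cumArrival A L (A m + u) := by
      have h3 : ∑ j ∈ Finset.Icc m n, ((L j : ℕ) : ℝ≥0∞)
          = ∑' j, if j ∈ Finset.Icc m n then ((L j : ℕ) : ℝ≥0∞) else 0 := by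
        rw [tsum_eq_sum (s := Finset.Icc m n)]
        · exact Finset.sum_congr rfl fun j hj => (if_pos hj).symm
        · intro k hk
          exact if_neg hk
      rw [h3]
      unfold cumArrival
      rw [← ENNReal.tsum_add]
      refine ENNReal.tsum_le_tsum fun k => ?_
      by_cases hk : k ∈ Finset.Icc m n
      · have hk' := Finset.mem_Icc.1 hk
        rw [if_pos hk, if_neg (not_lt.2 (hA hk'.1)), zero_add,
          if_pos ((hA hk'.2).trans_lt hut)]
      · rw [if_neg hk, add_zero]
        by_cases hkm : A k < A m
        · rw [if_pos hkm, if_pos (hkm.trans_le le_self_add)]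
        · rw [if_neg hkm]; exact zero_le
    have h4 := (ENNReal.add_le_add_iff_left hfin).1 (h2.trans h1)
    rw [← ENNReal.coe_le_coe]
    push_cast
    exact h4
  · intro h s t hst
    have key : ∀ N : ℕ, ∑ k ∈ Finset.range N, (if A k < t then ((L k : ℕ) : ℝ≥0∞) else 0)
        ≤ cumArrival A L s + (σ (t - s) : ℝ≥0∞) := by
      intro N
      let F := (Finset.range N).filter (fun k => s ≤ A k ∧ A k < t)
      have hle : ∑ k ∈ Finset.range N, (if A k < t then ((L k : ℕ) : ℝ≥0∞) else 0)
          ≤ ∑ k ∈ Finset.range N, ((if A k < s then ((L k : ℕ) : ℝ≥0∞) else 0)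
            + (if s ≤ A k ∧ A k < t then ((L k : ℕ) : ℝ≥0∞) else 0)) := by
        refine Finset.sum_le_sum fun k _ => ?_
        by_cases h1 : A k < t
        · by_cases h2 : A k < s
          · simp [h1, h2]
          · simp [h1, not_lt.1 h2]
        · simp [h1]
      refine hle.trans ?_
      rw [Finset.sum_add_distrib]
      refine add_le_add (ENNReal.sum_le_tsum _) ?_
      rw [← Finset.sum_filter]
      change ∑ k ∈ F, ((L k : ℕ) : ℝ≥0∞) ≤ _
      rcases F.eq_empty_or_nonempty with hF | hF
      · rw [hF]; simp
      · have hm := (Finset.mem_filter.1 (F.min'_mem hF)).2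
        have hn := (Finset.mem_filter.1 (F.max'_mem hF)).2
        have hmn := F.min'_le _ (F.max'_mem hF)
        have hsub : F ⊆ Finset.Icc (F.min' hF) (F.max' hF) := fun k hk =>
          Finset.mem_Icc.2 ⟨F.min'_le _ hk, F.le_max' _ hk⟩
        have hlt : A (F.max' hF) - A (F.min' hF) < t - s :=
          (tsub_le_tsub_left hm.1 _).trans_lt (tsub_lt_tsub_right_of_le hn.1 hn.2)
        have h5 := h _ _ hmn _ hlt
        rw [← ENNReal.coe_le_coe] at h5
        push_cast at h5
        exact (Finset.sum_le_sum_of_subset hsub).trans h5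
    conv_lhs => unfold cumArrival
    rw [ENNReal.tsum_eq_iSup_nat]
    exact iSup_le key
end

section
/- Let (A, L) be a single-flow packet sequence with A : ℕ⁺ → [0,∞) wide-sense increasing and L : ℕ⁺ → ℕ⁺, let R be its cumulative arrival function, let λ : [0,∞) → [0,∞) be wide-sense increasing, and set σ = λ↓ (the lower pseudo-inverse of λ, with values in [0,∞]). Then the following three conditions are equivalent: (1) R(t) ≤ R(s) + σ(t−s) for all 0 ≤ s ≤ t; (2) for all m, n ∈ ℕ⁺ with m ≤ n: Σ_{j=m}^{n} L_j ≤ λ↑(A_n − A_m); (3) for all m, n ∈ ℕ⁺ with m ≤ n: A_n − A_m ≥ λ⁻(Σ_{j=m}^{n} L_j). -/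
open scoped NNReal ENNReal

theorem aux_upper (lam : ℝ≥0 → ℝ≥0) (hlam : Monotone lam) (S d : ℝ≥0) :
    (S : ℝ≥0∞) ≤ upperPseudoInv lam d ↔ ∀ x < S, lam x ≤ d := by
  unfold upperPseudoInv
  constructor
  · intro h x hx
    have h1 : (x : ℝ≥0∞) < ⨆ s : {s : ℝ≥0 // lam s ≤ d}, ((s : ℝ≥0) : ℝ≥0∞) :=
      lt_of_lt_of_le (by exact_mod_cast hx) h
    obtain ⟨⟨s, hs⟩, h2⟩ := lt_iSup_iff.1 h1
    have h3 : x < s := by exact_mod_cast h2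
    exact (hlam h3.le).trans hs
  · intro h
    refine le_of_forall_lt fun c hc => ?_
    obtain ⟨y, hcy, hyS⟩ := ENNReal.lt_iff_exists_nnreal_btwn.1 hc
    have hy : y < S := by exact_mod_cast hyS
    exact lt_of_lt_of_le hcy
      (le_iSup (fun s : {s : ℝ≥0 // lam s ≤ d} => ((s : ℝ≥0) : ℝ≥0∞)) ⟨y, h y hy⟩)

theorem aux_left (lam : ℝ≥0 → ℝ≥0) (hlam : Monotone lam) (S d : ℝ≥0) (hS : 0 < S) :
    leftLim' lam S ≤ d ↔ ∀ x < S, lam x ≤ d := by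
  unfold leftLim'
  haveI : Nonempty {s : ℝ≥0 // s < S} := ⟨⟨0, hS⟩⟩
  rw [ciSup_le_iff]
  · exact ⟨fun h x hx => h ⟨x, hx⟩, fun h x => h x.1 x.2⟩
  · refine ⟨lam S, ?_⟩
    rintro _ ⟨x, rfl⟩
    exact hlam x.2.le

theorem aux_main (A : ℕ → ℝ≥0) (L : ℕ → ℕ+) (hA : Monotone A) (lam : ℝ≥0 → ℝ≥0) :
    (∀ s t : ℝ≥0, s ≤ t →
        cumArrival A L t ≤ cumArrival A L s + lowerPseudoInv lam (t - s)) ↔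
      (∀ m n : ℕ, m ≤ n → ∀ x < ((∑ j ∈ Finset.Icc m n, (L j : ℕ) : ℕ) : ℝ≥0),
        lam x ≤ A n - A m) := by
  constructor
  · intro h m n hmn x hx
    by_contra! hlt
    have h1 := h (A m) (A m + lam x) le_self_add
    rw [add_tsub_cancel_left] at h1
    have h2 : lowerPseudoInv lam (lam x) ≤ x :=
      iInf_le (fun s : {s : ℝ≥0 // lam x ≤ lam s} => ((s : ℝ≥0) : ℝ≥0∞)) ⟨x, le_rfl⟩
    have hn : A n < A m + lam x := by
      have := (tsub_lt_iff_left (hA hmn)).1 hlt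
      exact this
    have hfin : cumArrival A L (A m) ≠ ⊤ := by
      unfold cumArrival
      rw [tsum_eq_sum (s := Finset.range m)]
      · refine (ENNReal.sum_lt_top.2 fun k _ => ?_).ne
        split_ifs <;> simp
      · intro k hk
        rw [if_neg]
        exact not_lt.2 (hA (by simpa using hk))
    have h3 : cumArrival A L (A m) + (((∑ j ∈ Finset.Icc m n, (L j : ℕ) : ℕ) : ℝ≥0) : ℝ≥0∞)
        ≤ cumArrival A L (A m + lam x) := by
      have e : (((∑ j ∈ Finset.Icc m n, (L j : ℕ) : ℕ) : ℝ≥0) : ℝ≥0∞)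
          = ∑' k, if k ∈ Finset.Icc m n then ((L k : ℕ) : ℝ≥0∞) else 0 := by
        rw [tsum_eq_sum (s := Finset.Icc m n) (fun k hk => if_neg hk)]
        rw [Finset.sum_congr rfl (fun k hk => if_pos hk)]
        push_cast
        rfl
      rw [e]
      unfold cumArrival
      rw [← ENNReal.tsum_add]
      refine ENNReal.tsum_le_tsum fun k => ?_
      by_cases hk : k ∈ Finset.Icc m n
      · have hk' := Finset.mem_Icc.1 hk
        rw [if_neg (not_lt.2 (hA hk'.1)), if_pos hk, if_pos ((hA hk'.2).trans_lt hn), zero_add]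
      · rw [if_neg hk, add_zero]
        by_cases hk2 : A k < A m
        · rw [if_pos hk2, if_pos (hk2.trans_le le_self_add)]
        · rw [if_neg hk2]; exact zero_le
    have h4 := h3.trans (h1.trans (add_le_add le_rfl h2))
    have h5 := (ENNReal.add_le_add_iff_left hfin).1 h4
    have h6 := ENNReal.coe_le_coe.1 h5
    exact absurd hx (not_lt.2 h6)
  · intro h s t hst
    unfold lowerPseudoInv
    rw [ENNReal.add_iInf]
    refine le_iInf ?_
    rintro ⟨x, hx⟩
    show cumArrival A L t ≤ cumArrival A L s + (x : ℝ≥0∞)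
    conv_lhs => unfold cumArrival
    rw [ENNReal.tsum_eq_iSup_nat]
    refine iSup_le fun N => ?_
    set F := (Finset.range N).filter (fun k => s ≤ A k ∧ A k < t) with hF
    have hsum : (∑ k ∈ F, ((L k : ℕ) : ℝ≥0∞)) ≤ x := by
      rcases F.eq_empty_or_nonempty with h0 | hne
      · rw [h0]; simp
      · have hm := F.min'_mem hne
        have hM := F.max'_mem hne
        set m := F.min' hne
        set n := F.max' hne
        have hmn : m ≤ n := F.min'_le _ hM
        have hm2 := (Finset.mem_filter.1 hm).2
        have hM2 := (Finset.mem_filter.1 hM).2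
        have hsub : F ⊆ Finset.Icc m n := fun k hk =>
          Finset.mem_Icc.2 ⟨F.min'_le _ hk, F.le_max' _ hk⟩
        have hle : ((∑ j ∈ Finset.Icc m n, (L j : ℕ) : ℕ) : ℝ≥0) ≤ x := by
          by_contra! hlt
          have h1 := hx.trans (h m n hmn x hlt)
          have h2 : t ≤ A n - A m + s := tsub_le_iff_right.1 h1
          have h3 : A n - A m + s ≤ A n - A m + A m := add_le_add le_rfl hm2.1
          rw [tsub_add_cancel_of_le (hA hmn)] at h3
          exact absurd hM2.2 (not_lt.2 (h2.trans h3))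
        refine (Finset.sum_le_sum_of_subset hsub).trans ?_
        have := ENNReal.coe_le_coe.2 hle
        push_cast at this
        exact this
    have hs : (∑ k ∈ Finset.range N, if A k < s then ((L k : ℕ) : ℝ≥0∞) else 0)
        ≤ cumArrival A L s := ENNReal.sum_le_tsum _
    refine le_trans ?_ (add_le_add hs hsum)
    rw [hF, Finset.sum_filter, ← Finset.sum_add_distrib]
    refine Finset.sum_le_sum fun k _ => ?_
    by_cases h1 : A k < t
    · by_cases h2 : A k < s
      · simp [h1, h2]
      · simp [h1, h2, not_lt.1 h2]
    · simp [h1]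

/-- with `σ = λ↓`, equivalence of the arrival-curve constraint with the
packet-time conditions via `λ↑` and `λ⁻` (the max-plus form of the duality). -/
theorem arrivalCurve_iff_packetTimes_maxPlus (A : ℕ → ℝ≥0) (L : ℕ → ℕ+) (hA : Monotone A)
    (lam : ℝ≥0 → ℝ≥0) (hlam : Monotone lam) :
    ((∀ s t : ℝ≥0, s ≤ t →
        cumArrival A L t ≤ cumArrival A L s + lowerPseudoInv lam (t - s)) ↔
      (∀ m n : ℕ, m ≤ n →
        (((∑ j ∈ Finset.Icc m n, (L j : ℕ) : ℕ) : ℝ≥0) : ℝ≥0∞)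
          ≤ upperPseudoInv lam (A n - A m))) ∧
    ((∀ m n : ℕ, m ≤ n →
        (((∑ j ∈ Finset.Icc m n, (L j : ℕ) : ℕ) : ℝ≥0) : ℝ≥0∞)
          ≤ upperPseudoInv lam (A n - A m)) ↔
      (∀ m n : ℕ, m ≤ n →
        leftLim' lam ((∑ j ∈ Finset.Icc m n, (L j : ℕ) : ℕ) : ℝ≥0) ≤ A n - A m)) := by
  have key2 : ∀ m n : ℕ, m ≤ n → (0 : ℝ≥0) < ((∑ j ∈ Finset.Icc m n, (L j : ℕ) : ℕ) : ℝ≥0) := by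
    intro m n hmn
    exact Nat.cast_pos.2 (Finset.sum_pos (fun j _ => (L j).pos) ⟨m, Finset.mem_Icc.2 ⟨le_rfl, hmn⟩⟩)
  constructor
  · rw [aux_main A L hA lam]
    exact forall_congr' fun m => forall_congr' fun n => forall_congr' fun _ =>
      (aux_upper lam hlam _ _).symm
  · exact forall_congr' fun m => forall_congr' fun n => forall_congr' fun hmn =>
      (aux_upper lam hlam _ _).trans (aux_left lam hlam _ _ (key2 m n hmn)).symm
end

section
/- If a regulation operator Π satisfies causality (C2) and homogeneity (C3), then Π(A, L)_1 = −∞ for every packet sequence (A, L). -/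
/-- A regulation operator maps a single-flow packet sequence `(A, L)`
(with `A : ℕ → ℝ` the arrival dates, indexed from `0`, and `L : ℕ → ℕ+` the packet
lengths) to a sequence of values in `[-∞, +∞) = WithBot ℝ`. -/
abbrev RegOp : Type := (ℕ → ℝ) → (ℕ → ℕ+) → ℕ → WithBot ℝ

/-- Condition C2 (causality): `Π(A,L)_n` depends only on `A_m` for `m < n`
and on `L_m` for `m ≤ n`. -/
def Causal (P : RegOp) : Prop :=
  ∀ (A A' : ℕ → ℝ) (L L' : ℕ → ℕ+), Monotone A → Monotone A' →
    ∀ n : ℕ, (∀ m, m < n → A m = A' m) → (∀ m, m ≤ n → L m = L' m) →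
      P A L n = P A' L' n

/-- Condition C3 (homogeneity): `Π(A + h, L) = Π(A, L) + h` for every real `h`. -/
def Homogeneous (P : RegOp) : Prop :=
  ∀ (A : ℕ → ℝ) (L : ℕ → ℕ+) (h : ℝ), Monotone A →
    ∀ n : ℕ, P (fun k => A k + h) L n = P A L n + (h : WithBot ℝ)

/-- Condition C4 (isotonicity): if `A ≤ A'` pointwise then `Π(A,L) ≤ Π(A',L)` pointwise. -/
def IsotoneOp (P : RegOp) : Prop :=
  ∀ (A A' : ℕ → ℝ) (L : ℕ → ℕ+), Monotone A → Monotone A' →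
    (∀ n, A n ≤ A' n) → ∀ n : ℕ, P A L n ≤ P A' L n

/-- The packet sequence `(A, L)` is `Π`-regular: `A_n ≥ Π(A,L)_n` for all `n`. -/
def PiRegular (P : RegOp) (A : ℕ → ℝ) (L : ℕ → ℕ+) : Prop :=
  ∀ n : ℕ, P A L n ≤ (A n : WithBot ℝ)

/-- a causal and homogeneous regulation operator satisfies
`Π(A, L)_1 = -∞` (here packet 1 has index `0`). -/
theorem regOp_first_eq_bot (P : RegOp) (hC : Causal P) (hH : Homogeneous P) :
    ∀ (A : ℕ → ℝ) (L : ℕ → ℕ+), Monotone A → P A L 0 = ⊥ := by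
  intro A L hA
  have h1 := hH A L 1 hA 0
  have h2 := hC A (fun k => A k + 1) L L hA (fun a b hab => by
    have := hA hab
    simpa using this) 0 (fun m hm => absurd hm (Nat.not_lt_zero m)) (fun _ _ => rfl)
  rw [← h2] at h1
  generalize P A L 0 = x at h1
  induction x using WithBot.recBotCoe with
  | bot => rfl
  | coe r =>
    exfalso
    rw [← WithBot.coe_add, WithBot.coe_inj] at h1
    linarith
end

section
/- Let Π be a regulation operator satisfying C2, C3 and C4, and let (A, L) be a packet sequence. There exists a unique sequence D : ℕ⁺ → ℝ with D_1 = A_1 and D_n = max{A_n, D_{n−1}, Π(D, L)_n} for all n ≥ 2; moreover D is wide-sense increasing, D_n ≥ A_n for all n, and (D, L) is Π-regular. In other words, the minimal Π-regulator is well defined and is a Π-regulator for the flow (A, L). -/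
/-- `D` satisfies the input-output equations of the minimal `Π`-regulator for
input `(A, L)`: `D_1 = A_1` and `D_n = max{A_n, D_{n-1}, Π(D,L)_n}` for `n ≥ 2`
(indices shifted to start at `0`). -/
def MinRegRec (P : RegOp) (A : ℕ → ℝ) (L : ℕ → ℕ+) (D : ℕ → ℝ) : Prop :=
  D 0 = A 0 ∧ ∀ n : ℕ,
    ((D (n + 1) : ℝ) : WithBot ℝ) =
      ((A (n + 1) : ℝ) : WithBot ℝ) ⊔ ((D n : ℝ) : WithBot ℝ) ⊔ P D L (n + 1)

noncomputable def mrE (P : RegOp) (A : ℕ → ℝ) (L : ℕ → ℕ+) : ℕ → ℕ → ℝ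
  | 0 => fun _ => A 0
  | n + 1 => fun k => if k ≤ n then mrE P A L n k else
      A (n + 1) ⊔ mrE P A L n n ⊔ (P (mrE P A L n) L (n + 1)).unbotD (mrE P A L n n)

theorem mrE_ge (P : RegOp) (A : ℕ → ℝ) (L : ℕ → ℕ+) (n k : ℕ) (h : n ≤ k) :
    mrE P A L n k = mrE P A L n n := by
  cases n with
  | zero => simp [mrE]
  | succ n =>
    have : ¬ k ≤ n := by omega
    simp [mrE, this]

theorem mrE_le (P : RegOp) (A : ℕ → ℝ) (L : ℕ → ℕ+) (n k : ℕ) (h : k ≤ n) :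
    mrE P A L n k = mrE P A L k k := by
  induction n, h using Nat.le_induction with
  | base => rfl
  | succ n hn ih => rw [← ih]; simp [mrE, hn]

theorem mrE_coe (a d : ℝ) (p : WithBot ℝ) :
    ((a ⊔ d ⊔ p.unbotD d : ℝ) : WithBot ℝ) = (a : WithBot ℝ) ⊔ (d : WithBot ℝ) ⊔ p := by
  cases p with
  | bot => simp
  | coe x => simp [WithBot.coe_sup]

theorem mrRec_mono {P : RegOp} {A : ℕ → ℝ} {L : ℕ → ℕ+} {D : ℕ → ℝ}
    (h : MinRegRec P A L D) : Monotone D := by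
  apply monotone_nat_of_le_succ
  intro n
  have := h.2 n
  rw [← WithBot.coe_le_coe, this]
  exact le_sup_of_le_left le_sup_right

/-- the minimal `Π`-regulator is well defined (the recursion has a unique
solution), and it is a `Π`-regulator: its output `D` is wide-sense increasing,
satisfies `D ≥ A`, and `(D, L)` is `Π`-regular. -/
theorem minReg_exists_unique (P : RegOp) (hC : Causal P) (hH : Homogeneous P)
    (hI : IsotoneOp P) (A : ℕ → ℝ) (L : ℕ → ℕ+) (hA : Monotone A) :
    ∃ D : ℕ → ℝ, MinRegRec P A L D ∧
      (∀ D' : ℕ → ℝ, MinRegRec P A L D' → D' = D) ∧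
      Monotone D ∧ (∀ n, A n ≤ D n) ∧ PiRegular P D L := by
  have hDm : Monotone (fun n => mrE P A L n n) := by
    apply monotone_nat_of_le_succ
    intro n
    simp [mrE]
  have hEm : ∀ n, Monotone (mrE P A L n) := by
    intro n i j hij
    have key : ∀ k, mrE P A L n k = mrE P A L (min k n) (min k n) := by
      intro k
      rcases le_total k n with h | h
      · rw [min_eq_left h, mrE_le P A L n k h]
      · rw [min_eq_right h, mrE_ge P A L n k h]
    rw [key i, key j]
    exact hDm (min_le_min_right n hij)
  have hrec : MinRegRec P A L (fun n => mrE P A L n n) := by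
    refine ⟨rfl, fun n => ?_⟩
    have h1 : P (fun n => mrE P A L n n) L (n + 1) = P (mrE P A L n) L (n + 1) :=
      hC _ _ L L hDm (hEm n) _ (fun m hm => (mrE_le P A L n m (by omega)).symm)
        (fun _ _ => rfl)
    rw [h1, ← mrE_coe]
    simp [mrE]
  refine ⟨_, hrec, ?_, hDm, ?_, ?_⟩
  · intro D' h'
    funext n
    induction n using Nat.strong_induction_on with
    | _ n ih =>
      cases n with
      | zero => exact h'.1.trans hrec.1.symm
      | succ n =>
        rw [← WithBot.coe_inj, h'.2 n, hrec.2 n, ih n (by omega),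
          hC _ _ L L (mrRec_mono h') hDm (n + 1) (fun m hm => ih m hm) (fun _ _ => rfl)]
  · intro n
    cases n with
    | zero => exact hrec.1.ge
    | succ n =>
      rw [← WithBot.coe_le_coe, hrec.2 n]
      exact le_sup_of_le_left le_sup_left
  · intro n
    cases n with
    | zero =>
      have h0 := hH A L 1 hA 0
      have h1 := hC (fun k => A k + 1) A L L (hA.add_const 1) hA 0
        (fun m hm => absurd hm (by omega)) (fun _ _ => rfl)
      have h2 := hC (fun n => mrE P A L n n) A L L hDm hA 0
        (fun m hm => absurd hm (by omega)) (fun _ _ => rfl)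
      rw [h1] at h0
      rw [h2]
      cases hp : P A L 0 with
      | bot => exact bot_le
      | coe x =>
        rw [hp, ← WithBot.coe_add, WithBot.coe_inj] at h0
        linarith
    | succ n =>
      rw [hrec.2 n]
      exact le_sup_right
end

section
/- Let Π be a regulation operator satisfying C2, C3 and C4, let (A, L) be a packet sequence, and let D be the minimal Π-regulator output, i.e., the unique sequence with D_1 = A_1 and D_n = max{A_n, D_{n−1}, Π(D, L)_n} for n ≥ 2. Then for any Π-regulator output D′ for the input (A, L) — i.e., any wide-sense increasing D′ : ℕ⁺ → ℝ with A ≤ D′ pointwise such that (D′, L) is Π-regular — we have D′_n ≥ D_n for all n ∈ ℕ⁺. -/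
/-- minimality of the minimal `Π`-regulator: any `Π`-regulator output `D'`
for the same input `(A, L)` satisfies `D' ≥ D` pointwise. -/
theorem minReg_minimal (P : RegOp) (hC : Causal P) (hH : Homogeneous P)
    (hI : IsotoneOp P) (A : ℕ → ℝ) (L : ℕ → ℕ+) (hA : Monotone A)
    (D : ℕ → ℝ) (hD : MinRegRec P A L D)
    (D' : ℕ → ℝ) (hD'mono : Monotone D') (hD'fifo : ∀ n, A n ≤ D' n)
    (hD'reg : PiRegular P D' L) :
    ∀ n : ℕ, D n ≤ D' n := by
  have hDm : Monotone D := by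
    refine monotone_nat_of_le_succ fun n => ?_
    have h : ((D n : ℝ) : WithBot ℝ) ≤ ((D (n + 1) : ℝ) : WithBot ℝ) := by
      rw [hD.2 n]
      exact le_sup_of_le_left le_sup_right
    exact WithBot.coe_le_coe.1 h
  intro n
  induction n using Nat.strong_induction_on with
  | _ n ih =>
    cases n with
    | zero => rw [hD.1]; exact hD'fifo 0
    | succ n =>
      have hEm : Monotone (fun k => D (min k n)) := fun a b hab =>
        hDm (min_le_min_right n hab)
      have h1 : P D L (n + 1) = P (fun k => D (min k n)) L (n + 1) := by
        refine hC _ _ L L hDm hEm (n + 1) (fun m hm => ?_) (fun _ _ => rfl)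
        have : min m n = m := by omega
        simp only [this]
      have h2 : P (fun k => D (min k n)) L (n + 1) ≤ P D' L (n + 1) :=
        hI _ _ L hEm hD'mono (fun k => (ih (min k n) (by omega)).trans
          (hD'mono (min_le_left k n))) (n + 1)
      apply WithBot.coe_le_coe.1
      rw [hD.2 n]
      refine sup_le (sup_le ?_ ?_) ?_
      · exact WithBot.coe_le_coe.2 (hD'fifo _)
      · exact WithBot.coe_le_coe.2 ((ih n (by omega)).trans (hD'mono (Nat.le_succ n)))
      · rw [h1]
        exact h2.trans (hD'reg _)
end

section
/- Let Π be a regulation operator satisfying C2, C3 and C4, let (A, L) be a packet sequence, and let D be the minimal Π-regulator output, i.e., the unique sequence with D_1 = A_1 and D_n = max{A_n, D_{n−1}, Π(D, L)_n} for n ≥ 2. Then the flow (A, L) is Π-regular if and only if D = A. -/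
/-- the flow `(A, L)` is `Π`-regular if and only if the minimal
`Π`-regulator output `D` equals `A`. -/
theorem minReg_identity_iff_regular (P : RegOp) (hC : Causal P) (hH : Homogeneous P)
    (hI : IsotoneOp P) (A : ℕ → ℝ) (L : ℕ → ℕ+) (hA : Monotone A)
    (D : ℕ → ℝ) (hD : MinRegRec P A L D) :
    PiRegular P A L ↔ D = A := by
  have hDm : Monotone D := by
    refine monotone_nat_of_le_succ fun n => ?_
    have h := hD.2 n
    have h2 : ((D n : ℝ) : WithBot ℝ) ≤ ((D (n + 1) : ℝ) : WithBot ℝ) := by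
      rw [h]
      exact le_sup_of_le_left le_sup_right
    exact WithBot.coe_le_coe.mp h2
  constructor
  · intro hR
    funext n
    induction n using Nat.strong_induction_on with
    | _ n ih =>
      cases n with
      | zero => exact hD.1
      | succ n =>
        have h := hD.2 n
        rw [hC D A L L hDm hA (n + 1) (fun m hm => ih m hm) (fun _ _ => rfl),
          ih n (Nat.lt_succ_self n),
          sup_eq_left.mpr (WithBot.coe_le_coe.mpr (hA (Nat.le_succ n))),
          sup_eq_left.mpr (hR (n + 1))] at h
        exact WithBot.coe_injective h
  · rintro rfl n
    cases n with
    | zero =>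
      have h1 := hH D L 1 hA 0
      have h2 := hC (fun k => D k + 1) D L L (fun a b hab => by
        have := hA hab
        simpa using this) hA 0 (fun m hm => absurd hm (Nat.not_lt_zero m)) (fun _ _ => rfl)
      rw [h2] at h1
      cases hx : P D L 0 with
      | bot => exact bot_le
      | coe x =>
        rw [hx, ← WithBot.coe_add] at h1
        have h3 : x = x + 1 := WithBot.coe_injective h1
        linarith
    | succ n =>
      rw [hD.2 n]
      exact le_sup_right
end

section
/- Let Π be a regulation operator satisfying C2, C3 and C4. Let (A, L) be a Π-regular packet sequence, let D : ℕ⁺ → ℝ be wide-sense increasing with A ≤ D pointwise (the output of an arbitrary system that is FIFO for this flow), and let E be the minimal Π-regulator output for the input (D, L), i.e., E_1 = D_1 and E_n = max{D_n, E_{n−1}, Π(E, L)_n} for n ≥ 2. Then sup_{n∈ℕ⁺}(D_n − A_n) = sup_{n∈ℕ⁺}(E_n − A_n) (as elements of [0,∞]); that is, the minimal Π-regulator placed after the FIFO system does not increase the worst-case delay of the flow. -/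
/-- Theorem: minimal per-flow regulator does not increase worst-case delay:
if a `Π`-regular flow `(A, L)` traverses a system that is FIFO for the flow, with output
dates `D ≥ A`, and the output is fed to the minimal `Π`-regulator, with output dates `E`,
then `sup_n (D_n - A_n) = sup_n (E_n - A_n)` in `[0,∞]`. -/
theorem minReg_no_delay_increase (P : RegOp) (hC : Causal P) (hH : Homogeneous P)
    (hI : IsotoneOp P) (A : ℕ → ℝ) (L : ℕ → ℕ+) (hA : Monotone A)
    (hAreg : PiRegular P A L)
    (D : ℕ → ℝ) (hDmono : Monotone D) (hAD : ∀ n, A n ≤ D n)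
    (E : ℕ → ℝ) (hE : MinRegRec P D L E) :
    ⨆ n : ℕ, ENNReal.ofReal (D n - A n) = ⨆ n : ℕ, ENNReal.ofReal (E n - A n) := by
  have hDE : ∀ n, D n ≤ E n := by
    intro n
    cases n with
    | zero => exact hE.1.ge
    | succ n =>
      have h := hE.2 n
      have : ((D (n + 1) : ℝ) : WithBot ℝ) ≤ ((E (n + 1) : ℝ) : WithBot ℝ) := by
        rw [h]
        exact le_sup_of_le_left le_sup_left
      exact WithBot.coe_le_coe.1 this
  have hEm : Monotone E := by
    refine monotone_nat_of_le_succ fun n => ?_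
    have h := hE.2 n
    have : ((E n : ℝ) : WithBot ℝ) ≤ ((E (n + 1) : ℝ) : WithBot ℝ) := by
      rw [h]
      exact le_sup_of_le_left le_sup_right
    exact WithBot.coe_le_coe.1 this
  have key : ∀ h : ℝ, (∀ n, D n ≤ A n + h) → ∀ n, E n ≤ A n + h := by
    intro h hD n
    induction n using Nat.strong_induction_on with
    | _ n ih =>
      cases n with
      | zero => rw [hE.1]; exact hD 0
      | succ n =>
        have hAh : Monotone (fun k => A k + h) := hA.add_const h
        have hmin : Monotone (fun k => min (E k) (A k + h)) := hEm.min hAh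
        have h1 : P E L (n + 1) = P (fun k => min (E k) (A k + h)) L (n + 1) :=
          hC _ _ _ _ hEm hmin _ (fun m hm => (min_eq_left (ih m hm)).symm) (fun _ _ => rfl)
        have h2 : P E L (n + 1) ≤ P A L (n + 1) + (h : WithBot ℝ) := by
          rw [h1, ← hH A L h hA]
          exact hI _ _ _ hmin hAh (fun k => min_le_right _ _) _
        have h3 : P E L (n + 1) ≤ ((A (n + 1) + h : ℝ) : WithBot ℝ) := by
          refine h2.trans ?_
          rw [WithBot.coe_add]
          exact add_le_add (hAreg (n + 1)) le_rfl
        have h4 : ((E (n + 1) : ℝ) : WithBot ℝ) ≤ ((A (n + 1) + h : ℝ) : WithBot ℝ) := by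
          rw [hE.2 n]
          refine sup_le (sup_le (WithBot.coe_le_coe.2 (hD _)) (WithBot.coe_le_coe.2 ?_)) h3
          exact (ih n (Nat.lt_succ_self n)).trans (hAh (Nat.le_succ n))
        exact WithBot.coe_le_coe.1 h4
  apply le_antisymm
  · exact iSup_mono fun n => ENNReal.ofReal_le_ofReal (sub_le_sub_right (hDE n) _)
  · by_cases htop : (⨆ n : ℕ, ENNReal.ofReal (D n - A n)) = ⊤
    · rw [htop]; exact le_top
    · refine iSup_le fun n => ?_
      rw [ENNReal.ofReal_le_iff_le_toReal htop]
      have := key (⨆ n : ℕ, ENNReal.ofReal (D n - A n)).toReal (fun m => by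
        have := (ENNReal.ofReal_le_iff_le_toReal htop).1
          (le_iSup (fun n : ℕ => ENNReal.ofReal (D n - A n)) m)
        linarith) n
      linarith
end

section
/- Let (A, L, F) be a multi-flow packet sequence and, for every flow f, let Π^f be a regulation operator satisfying C2, C3 and C4. There exists a unique sequence D : ℕ⁺ → ℝ with D_1 = A_1 and D_n = max{A_n, D_{n−1}, Π^{F_n}(D^{F_n}, L^{F_n})_{I(n)}} for n ≥ 2; moreover D is wide-sense increasing, D_n ≥ A_n for all n, and for every flow f the output subsequence (D^f, L^f) is Π^f-regular. In other words, the minimal interleaved regulator is well defined and is an interleaved regulator for (A, L, F). -/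
/-- The subsequence of `X` consisting of the packets of flow `f` (for the flow
assignment `F`): `X^f_i = X_{ind(f,i)}`, where `ind(f,i)` is the `i`-th smallest
index `n` with `F n = f`. -/
noncomputable def subSeq {𝔽 : Type} {α : Type} (F : ℕ → 𝔽) (f : 𝔽) (X : ℕ → α) :
    ℕ → α :=
  fun i => X (Nat.nth (fun n => F n = f) i)

/-- `flowIdx F n` is the index `I(n)` of packet `n` within its flow
(`0`-based: the number of packets `m < n` with `F m = F n`). -/
noncomputable def flowIdx {𝔽 : Type} [DecidableEq 𝔽] (F : ℕ → 𝔽) (n : ℕ) : ℕ :=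
  Nat.count (fun m => F m = F n) n

/-- `D` satisfies the input-output equations of the minimal interleaved regulator for
the multi-flow input `(A, L, F)` and regulation operators `P f` (one per flow `f`):
`D_1 = A_1` and `D_n = max{A_n, D_{n-1}, Π^{F_n}(D^{F_n}, L^{F_n})_{I(n)}}` for `n ≥ 2`
(indices shifted to start at `0`). -/
def IRRec {𝔽 : Type} [DecidableEq 𝔽] (P : 𝔽 → RegOp) (A : ℕ → ℝ) (L : ℕ → ℕ+)
    (F : ℕ → 𝔽) (D : ℕ → ℝ) : Prop :=
  D 0 = A 0 ∧ ∀ n : ℕ,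
    ((D (n + 1) : ℝ) : WithBot ℝ) =
      ((A (n + 1) : ℝ) : WithBot ℝ) ⊔ ((D n : ℝ) : WithBot ℝ) ⊔
        P (F (n + 1)) (subSeq F (F (n + 1)) D) (subSeq F (F (n + 1)) L)
          (flowIdx F (n + 1))

theorem irrec_mono {𝔽 : Type} [DecidableEq 𝔽] {P : 𝔽 → RegOp} {A : ℕ → ℝ} {L : ℕ → ℕ+}
    {F : ℕ → 𝔽} {D : ℕ → ℝ} (h : IRRec P A L F D) : Monotone D := by
  refine monotone_nat_of_le_succ fun n => ?_
  rw [← WithBot.coe_le_coe, h.2 n]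
  exact le_sup_of_le_left le_sup_right

theorem subSeq_mono {𝔽 : Type} {F : ℕ → 𝔽} (f : 𝔽) {D : ℕ → ℝ}
    (hinf : ∀ f : 𝔽, {n : ℕ | F n = f}.Infinite) (h : Monotone D) : Monotone (subSeq F f D) :=
  fun _ _ hab => h (Nat.nth_monotone (hinf f) hab)

theorem P_congr {𝔽 : Type} [DecidableEq 𝔽] {P : 𝔽 → RegOp} (hC : ∀ f, Causal (P f))
    {L : ℕ → ℕ+} {F : ℕ → 𝔽} (hinf : ∀ f : 𝔽, {n : ℕ | F n = f}.Infinite)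
    {D D' : ℕ → ℝ} (h : Monotone D) (h' : Monotone D') (n : ℕ) (e : ∀ k < n, D k = D' k) :
    P (F n) (subSeq F (F n) D) (subSeq F (F n) L) (flowIdx F n) =
    P (F n) (subSeq F (F n) D') (subSeq F (F n) L) (flowIdx F n) := by
  refine hC _ _ _ _ _ (subSeq_mono _ hinf h) (subSeq_mono _ hinf h') _ ?_ (fun _ _ => rfl)
  intro m hm
  exact e _ (Nat.nth_lt_of_lt_count hm)

theorem P_zero {P : RegOp} (hC : Causal P) (hH : Homogeneous P) {A : ℕ → ℝ} (hA : Monotone A)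
    (L : ℕ → ℕ+) : P A L 0 = ⊥ := by
  have h1 := hH A L 1 hA 0
  have h2 := hC (fun k => A k + 1) A L L (fun a b hab => by simpa using hA hab) hA 0
    (by simp) (by simp)
  rw [h2] at h1
  cases hx : P A L 0 with
  | bot => rfl
  | coe x =>
    rw [hx, ← WithBot.coe_add, WithBot.coe_inj] at h1
    linarith

open Classical in
noncomputable def approxSeq {𝔽 : Type} [DecidableEq 𝔽] (P : 𝔽 → RegOp) (A : ℕ → ℝ) (L : ℕ → ℕ+)
    (F : ℕ → 𝔽) : ℕ → ℕ → ℝ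
  | 0 => fun _ => A 0
  | n + 1 => fun k => if k ≤ n then approxSeq P A L F n k else
      (A (n + 1) ⊔ approxSeq P A L F n n) ⊔
        WithBot.unbotD (A (n + 1)) (P (F (n + 1)) (subSeq F (F (n + 1)) (approxSeq P A L F n))
          (subSeq F (F (n + 1)) L) (flowIdx F (n + 1)))

theorem exists_irrec {𝔽 : Type} [DecidableEq 𝔽]
    (P : 𝔽 → RegOp) (hC : ∀ f, Causal (P f))
    (A : ℕ → ℝ) (L : ℕ → ℕ+) (F : ℕ → 𝔽)
    (hinf : ∀ f : 𝔽, {n : ℕ | F n = f}.Infinite) :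
    ∃ D : ℕ → ℝ, IRRec P A L F D := by
  set E := approxSeq P A L F with hE
  have hle : ∀ n k, k ≤ n → E (n + 1) k = E n k := by
    intro n k hk
    simp [hE, approxSeq, hk]
  have hgt : ∀ n k, n < k → E (n + 1) k = (A (n + 1) ⊔ E n n) ⊔
        WithBot.unbotD (A (n + 1)) (P (F (n + 1)) (subSeq F (F (n + 1)) (E n))
          (subSeq F (F (n + 1)) L) (flowIdx F (n + 1))) := by
    intro n k hk
    simp [hE, approxSeq, not_le.2 hk]
  have hmono : ∀ n, Monotone (E n) := by
    intro n
    induction n with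
    | zero => intro a b _; simp [hE, approxSeq]
    | succ n ih =>
      intro a b hab
      rcases le_or_gt b n with hb | hb
      · rw [hle n a (hab.trans hb), hle n b hb]; exact ih hab
      · rcases le_or_gt a n with ha | ha
        · rw [hle n a ha, hgt n b hb]
          exact le_sup_of_le_left (le_sup_of_le_right (ih ha))
        · rw [hgt n a ha, hgt n b hb]
  have hst : ∀ n k, k ≤ n → E n k = E k k := by
    intro n k hk
    induction n, hk using Nat.le_induction with
    | base => rfl
    | succ n hn ih => rw [hle n k hn, ih]
  have hD : Monotone (fun n => E n n) := by
    intro a b hab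
    show E a a ≤ E b b
    rw [← hst b a hab]
    exact hmono b hab
  refine ⟨fun n => E n n, rfl, fun n => ?_⟩
  rw [P_congr hC hinf hD (hmono n) (n + 1) (fun k hk => (hst n k (by omega)).symm)]
  show ((E (n + 1) (n + 1) : ℝ) : WithBot ℝ) = _
  rw [hgt n (n + 1) (by omega)]
  cases P (F (n + 1)) (subSeq F (F (n + 1)) (E n)) (subSeq F (F (n + 1)) L)
      (flowIdx F (n + 1)) with
  | bot => simp [WithBot.coe_sup]
  | coe x => simp [WithBot.coe_sup]

/-- the minimal interleaved regulator is well defined (the recursion has a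
unique solution) and is an interleaved regulator: its output `D` is wide-sense
increasing, satisfies `D ≥ A` (FIFO), and every flow `f` of the output is
`Π^f`-regular. -/
theorem minIR_exists_unique {𝔽 : Type} [Fintype 𝔽] [DecidableEq 𝔽]
    (P : 𝔽 → RegOp) (hC : ∀ f, Causal (P f)) (hH : ∀ f, Homogeneous (P f))
    (hI : ∀ f, IsotoneOp (P f))
    (A : ℕ → ℝ) (L : ℕ → ℕ+) (F : ℕ → 𝔽) (hA : Monotone A)
    (hinf : ∀ f : 𝔽, {n : ℕ | F n = f}.Infinite) :
    ∃ D : ℕ → ℝ, IRRec P A L F D ∧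
      (∀ D' : ℕ → ℝ, IRRec P A L F D' → D' = D) ∧
      Monotone D ∧ (∀ n, A n ≤ D n) ∧
      (∀ f : 𝔽, PiRegular (P f) (subSeq F f D) (subSeq F f L)) := by
  obtain ⟨D, hD⟩ := exists_irrec P hC A L F hinf
  have hm := irrec_mono hD
  refine ⟨D, hD, ?_, hm, ?_, ?_⟩
  · intro D' hD'
    have hm' := irrec_mono hD'
    funext n
    induction n using Nat.strong_induction_on with
    | _ n ih =>
      cases n with
      | zero => rw [hD.1, hD'.1]
      | succ n =>
        rw [← WithBot.coe_inj, hD.2 n, hD'.2 n, P_congr hC hinf hm' hm (n + 1) ih,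
          ih n (by omega)]
  · intro n
    cases n with
    | zero => rw [hD.1]
    | succ n =>
      rw [← WithBot.coe_le_coe, hD.2 n]
      exact le_sup_of_le_left le_sup_left
  · intro f i
    have h1 : F (Nat.nth (fun n => F n = f) i) = f := Nat.nth_mem_of_infinite (hinf f) i
    have h2 : Nat.count (fun n => F n = f) (Nat.nth (fun n => F n = f) i) = i :=
      Nat.count_nth_of_infinite (hinf f) i
    change _ ≤ ((D (Nat.nth (fun n => F n = f) i) : ℝ) : WithBot ℝ)
    generalize Nat.nth (fun n => F n = f) i = n at h1 h2
    cases n with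
    | zero =>
      rw [Nat.count_zero] at h2
      rw [← h2, P_zero (hC f) (hH f) (subSeq_mono f hinf hm)]
      exact bot_le
    | succ n =>
      subst h1
      rw [hD.2 n]
      refine le_sup_of_le_right (le_of_eq ?_)
      rw [flowIdx, h2]
end

section
/- Let (A, L, F) be a multi-flow packet sequence with, for every flow f, a regulation operator Π^f satisfying C2, C3 and C4, and let D be the minimal interleaved regulator output, i.e., the unique sequence with D_1 = A_1 and D_n = max{A_n, D_{n−1}, Π^{F_n}(D^{F_n}, L^{F_n})_{I(n)}} for n ≥ 2. Then for any interleaved regulator output D′ for the input (A, L, F) we have D′_n ≥ D_n for all n ∈ ℕ⁺. -/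
/-- minimality of the minimal interleaved regulator: any interleaved
regulator output `D'` for the same input `(A, L, F)` (i.e. any wide-sense increasing
`D' ≥ A` such that every flow `f` of `(D', L, F)` is `Π^f`-regular) satisfies
`D' ≥ D` pointwise. -/
theorem minIR_minimal {𝔽 : Type} [Fintype 𝔽] [DecidableEq 𝔽]
    (P : 𝔽 → RegOp) (hC : ∀ f, Causal (P f)) (hH : ∀ f, Homogeneous (P f))
    (hI : ∀ f, IsotoneOp (P f))
    (A : ℕ → ℝ) (L : ℕ → ℕ+) (F : ℕ → 𝔽) (hA : Monotone A)
    (hinf : ∀ f : 𝔽, {n : ℕ | F n = f}.Infinite)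
    (D : ℕ → ℝ) (hD : IRRec P A L F D)
    (D' : ℕ → ℝ) (hD'mono : Monotone D') (hD'fifo : ∀ n, A n ≤ D' n)
    (hD'reg : ∀ f : 𝔽, PiRegular (P f) (subSeq F f D') (subSeq F f L)) :
    ∀ n : ℕ, D n ≤ D' n := by
  obtain ⟨hD0, hDs⟩ := hD
  have hDmono : Monotone D := by
    refine monotone_nat_of_le_succ fun n => ?_
    have h := hDs n
    have h2 : ((D n : ℝ) : WithBot ℝ) ≤ ((D (n + 1) : ℝ) : WithBot ℝ) := by
      rw [h]
      exact le_sup_of_le_left le_sup_right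
    exact WithBot.coe_le_coe.mp h2
  have hsub : ∀ (f : 𝔽) (X : ℕ → ℝ), Monotone X → Monotone (subSeq F f X) := by
    intro f X hX
    exact hX.comp (Nat.nth_monotone (hinf f))
  intro n
  induction n using Nat.strong_induction_on with
  | _ n ih =>
    cases n with
    | zero => rw [hD0]; exact hD'fifo 0
    | succ n =>
      have hE : Monotone (fun k => min (D k) (D' k)) := hDmono.min hD'mono
      have h1 := hC (F (n + 1)) (subSeq F (F (n + 1)) D)
        (subSeq F (F (n + 1)) (fun k => min (D k) (D' k)))
        (subSeq F (F (n + 1)) L) (subSeq F (F (n + 1)) L)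
        (hsub _ _ hDmono) (hsub _ _ hE) (flowIdx F (n + 1))
        (fun m hm => (min_eq_left (ih _ (Nat.nth_lt_of_lt_count hm))).symm)
        (fun _ _ => rfl)
      have h2 := hI (F (n + 1)) (subSeq F (F (n + 1)) (fun k => min (D k) (D' k)))
        (subSeq F (F (n + 1)) D') (subSeq F (F (n + 1)) L)
        (hsub _ _ hE) (hsub _ _ hD'mono) (fun _ => min_le_right _ _) (flowIdx F (n + 1))
      have h3 := hD'reg (F (n + 1)) (flowIdx F (n + 1))
      have h4 : subSeq F (F (n + 1)) D' (flowIdx F (n + 1)) = D' (n + 1) := by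
        unfold subSeq flowIdx
        rw [Nat.nth_count (p := fun m => F m = F (n + 1)) rfl]
      rw [h4] at h3
      refine WithBot.coe_le_coe.mp ?_
      rw [hDs n]
      refine sup_le (sup_le ?_ ?_) ?_
      · exact WithBot.coe_le_coe.mpr (hD'fifo _)
      · exact WithBot.coe_le_coe.mpr ((ih n (Nat.lt_succ_self n)).trans (hD'mono (Nat.le_succ n)))
      · rw [h1]
        exact h2.trans h3
end

section
/- Let (A, L, F) be a multi-flow packet sequence with, for every flow f, a regulation operator Π^f satisfying C2, C3 and C4, and let D be the minimal interleaved regulator output, i.e., the unique sequence with D_1 = A_1 and D_n = max{A_n, D_{n−1}, Π^{F_n}(D^{F_n}, L^{F_n})_{I(n)}} for n ≥ 2. Then every flow f of (A, L, F) is Π^f-regular (i.e., (A^f, L^f) is Π^f-regular for every f) if and only if D = A. -/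
/-- every flow `f` of `(A, L, F)` is `Π^f`-regular if and only if the
minimal interleaved regulator output `D` equals `A`. -/
theorem minIR_identity_iff_regular {𝔽 : Type} [Fintype 𝔽] [DecidableEq 𝔽]
    (P : 𝔽 → RegOp) (hC : ∀ f, Causal (P f)) (hH : ∀ f, Homogeneous (P f))
    (hI : ∀ f, IsotoneOp (P f))
    (A : ℕ → ℝ) (L : ℕ → ℕ+) (F : ℕ → 𝔽) (hA : Monotone A)
    (hinf : ∀ f : 𝔽, {n : ℕ | F n = f}.Infinite)
    (D : ℕ → ℝ) (hD : IRRec P A L F D) :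
    (∀ f : 𝔽, PiRegular (P f) (subSeq F f A) (subSeq F f L)) ↔ D = A := by
  have hDm : Monotone D := monotone_nat_of_le_succ (fun n => by
    have h := hD.2 n
    have : ((D n : ℝ) : WithBot ℝ) ≤ ((D (n + 1) : ℝ) : WithBot ℝ) := by
      rw [h]; exact le_sup_of_le_left le_sup_right
    exact WithBot.coe_le_coe.mp this)
  have hsub : ∀ (X : ℕ → ℝ), Monotone X → ∀ f, Monotone (subSeq F f X) := by
    intro X hX f i j hij
    exact hX ((Nat.nth_monotone (hinf f)) hij)
  have hnth : ∀ n, Nat.nth (fun m => F m = F n) (flowIdx F n) = n := by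
    intro n
    exact Nat.nth_count (p := fun m => F m = F n) rfl
  constructor
  · intro hreg
    funext n
    induction n using Nat.strong_induction_on with
    | _ n ih =>
      cases n with
      | zero => exact hD.1
      | succ n =>
        have h := hD.2 n
        have e : P (F (n + 1)) (subSeq F (F (n + 1)) D) (subSeq F (F (n + 1)) L)
            (flowIdx F (n + 1)) = P (F (n + 1)) (subSeq F (F (n + 1)) A)
            (subSeq F (F (n + 1)) L) (flowIdx F (n + 1)) := by
          apply hC _ _ _ _ _ (hsub D hDm _) (hsub A hA _)
          · intro m hm
            apply ih
            have := (Nat.nth_strictMono (hinf (F (n + 1)))) hm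
            exact lt_of_lt_of_eq this (hnth (n + 1))
          · intro m _
            rfl
        have r := hreg (F (n + 1)) (flowIdx F (n + 1))
        have e2 : subSeq F (F (n + 1)) A (flowIdx F (n + 1)) = A (n + 1) :=
          congrArg A (hnth (n + 1))
        rw [e2] at r
        rw [e, ih n (Nat.lt_succ_self n), sup_eq_left.mpr
          (WithBot.coe_le_coe.mpr (hA (Nat.le_succ n))), sup_eq_left.mpr r] at h
        exact WithBot.coe_injective h
  · intro hDA f i
    subst hDA
    cases i with
    | zero =>
      have h1 := hH f (subSeq F f D) (subSeq F f L) 1 (hsub D hDm f) 0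
      have h2 := hC f (fun k => subSeq F f D k + 1) (subSeq F f D) (subSeq F f L)
        (subSeq F f L) (fun a b hab => by
          have := hsub D hDm f hab
          simpa using this) (hsub D hDm f) 0
        (fun m hm => absurd hm (Nat.not_lt_zero m)) (fun _ _ => rfl)
      rw [h2] at h1
      generalize P f (subSeq F f D) (subSeq F f L) 0 = x at h1 ⊢
      cases x with
      | bot => exact bot_le
      | coe x =>
        exfalso
        have h3 : x = x + 1 := WithBot.coe_injective (by rw [WithBot.coe_add]; exact h1)
        linarith
    | succ i =>
      have hF : F (Nat.nth (fun n => F n = f) (i + 1)) = f :=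
        Nat.nth_mem_of_infinite (hinf f) (i + 1)
      have hidx : flowIdx F (Nat.nth (fun n => F n = f) (i + 1)) = i + 1 := by
        unfold flowIdx
        simp only [hF]
        exact Nat.count_nth_of_infinite (hinf f) (i + 1)
      have hpos : 0 < Nat.nth (fun n => F n = f) (i + 1) :=
        lt_of_le_of_lt (Nat.zero_le _)
          ((Nat.nth_strictMono (hinf f)) (Nat.succ_pos i))
      change _ ≤ ((D (Nat.nth (fun n => F n = f) (i + 1)) : ℝ) : WithBot ℝ)
      obtain ⟨n, hn⟩ := Nat.exists_eq_succ_of_ne_zero hpos.ne'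
      rw [Nat.succ_eq_add_one] at hn
      rw [hn] at hF hidx ⊢
      have h := hD.2 n
      rw [hF, hidx] at h
      rw [h]
      exact le_sup_right
end

section
/- Let (A, L, F) be a multi-flow packet sequence with, for every flow f, a regulation operator Π^f satisfying C2, C3 and C4, and assume every input flow is regular: (A^f, L^f) is Π^f-regular for each f. Let D : ℕ⁺ → ℝ be wide-sense increasing with A ≤ D pointwise (the output of an arbitrary FIFO system), and let E be the minimal interleaved regulator output for the input (D, L, F), i.e., E_1 = D_1 and E_n = max{D_n, E_{n−1}, Π^{F_n}(E^{F_n}, L^{F_n})_{I(n)}} for n ≥ 2. Then sup_{n∈ℕ⁺}(D_n − A_n) = sup_{n∈ℕ⁺}(E_n − A_n) (as elements of [0,∞]); that is, the minimal interleaved regulator placed after the FIFO system does not increase the worst-case delay. -/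
/-- Theorem: minimal interleaved regulator does not increase worst-case
delay: if a multi-flow packet sequence `(A, L, F)` with every flow `Π^f`-regular
traverses a FIFO system with output dates `D ≥ A`, and the output is fed to the minimal
interleaved regulator, with output dates `E`, then
`sup_n (D_n - A_n) = sup_n (E_n - A_n)` in `[0,∞]`. -/
theorem minIR_no_delay_increase {𝔽 : Type} [Fintype 𝔽] [DecidableEq 𝔽]
    (P : 𝔽 → RegOp) (hC : ∀ f, Causal (P f)) (hH : ∀ f, Homogeneous (P f))
    (hI : ∀ f, IsotoneOp (P f))
    (A : ℕ → ℝ) (L : ℕ → ℕ+) (F : ℕ → 𝔽) (hA : Monotone A)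
    (hinf : ∀ f : 𝔽, {n : ℕ | F n = f}.Infinite)
    (hAreg : ∀ f : 𝔽, PiRegular (P f) (subSeq F f A) (subSeq F f L))
    (D : ℕ → ℝ) (hDmono : Monotone D) (hAD : ∀ n, A n ≤ D n)
    (E : ℕ → ℝ) (hE : IRRec P D L F E) :
    ⨆ n : ℕ, ENNReal.ofReal (D n - A n) = ⨆ n : ℕ, ENNReal.ofReal (E n - A n) := by
  obtain ⟨h0, hrec⟩ := hE
  have hDE : ∀ n, D n ≤ E n := by
    intro n
    cases n with
    | zero => exact h0.ge
    | succ n =>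
      have h : ((D (n + 1) : ℝ) : WithBot ℝ) ≤ ((E (n + 1) : ℝ) : WithBot ℝ) := by
        rw [hrec n]; exact le_sup_left.trans le_sup_left
      exact WithBot.coe_le_coe.1 h
  have hEmono : Monotone E := by
    refine monotone_nat_of_le_succ fun n => ?_
    have h : ((E n : ℝ) : WithBot ℝ) ≤ ((E (n + 1) : ℝ) : WithBot ℝ) := by
      rw [hrec n]; exact le_sup_right.trans le_sup_left
    exact WithBot.coe_le_coe.1 h
  apply le_antisymm
  · exact iSup_mono fun n => ENNReal.ofReal_le_ofReal (by linarith [hDE n])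
  by_cases htop : (⨆ n : ℕ, ENNReal.ofReal (D n - A n)) = ⊤
  · rw [htop]; exact le_top
  set d : ℝ := (⨆ n : ℕ, ENNReal.ofReal (D n - A n)).toReal with hd
  have hDd : ∀ n, D n ≤ A n + d := by
    intro n
    have h := (ENNReal.ofReal_le_iff_le_toReal htop).1
      (le_iSup (fun n : ℕ => ENNReal.ofReal (D n - A n)) n)
    linarith
  have hsub : ∀ (f : 𝔽) (X : ℕ → ℝ), Monotone X → Monotone (subSeq F f X) := by
    intro f X hX i j hij
    exact hX ((Nat.nth_strictMono (hinf f)).monotone hij)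
  have key : ∀ n, E n ≤ A n + d := by
    intro n
    induction n using Nat.strong_induction_on with
    | _ n ih =>
    cases n with
    | zero => rw [h0]; exact hDd 0
    | succ n =>
      have h : ((E (n + 1) : ℝ) : WithBot ℝ) ≤ ((A (n + 1) + d : ℝ) : WithBot ℝ) := by
        rw [hrec n]
        refine sup_le (sup_le (WithBot.coe_le_coe.2 (hDd _)) (WithBot.coe_le_coe.2 ?_)) ?_
        · linarith [ih n (Nat.lt_succ_self n), hA (Nat.le_succ n)]
        set f := F (n + 1) with hf
        have hAd : Monotone (fun k => subSeq F f A k + d) := (hsub f A hA).add_const d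
        have hmin : Monotone (fun k => min (subSeq F f E k) (subSeq F f A k + d)) :=
          (hsub f E hEmono).min hAd
        rw [hC f (subSeq F f E) (fun k => min (subSeq F f E k) (subSeq F f A k + d))
          (subSeq F f L) (subSeq F f L) (hsub f E hEmono) hmin (flowIdx F (n + 1)) ?_
          (fun _ _ => rfl)]
        · refine (hI f _ _ (subSeq F f L) hmin hAd (fun k => min_le_right _ _) _).trans ?_
          rw [hH f _ _ d (hsub f A hA)]
          have h1 := hAreg f (flowIdx F (n + 1))
          have h2 : subSeq F f A (flowIdx F (n + 1)) = A (n + 1) := by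
            unfold subSeq flowIdx
            rw [← hf, Nat.nth_count (p := fun m => F m = f) hf.symm]
          rw [h2] at h1
          rw [WithBot.coe_add]
          exact add_le_add_left h1 _
        · intro m hm
          exact (min_eq_left (ih _ (Nat.nth_lt_of_lt_count hm))).symm
      exact WithBot.coe_le_coe.1 h
  refine iSup_le fun n => ?_
  rw [ENNReal.ofReal_le_iff_le_toReal htop]
  linarith [key n]
end

section
/- Let (A, L, F) be a multi-flow packet sequence with, for every flow f, a regulation operator Π^f satisfying C2, C3 and C4. Let D : ℕ⁺ → ℝ be wide-sense increasing with A ≤ D pointwise. Let E be the minimal interleaved regulator output for the input (D, L, F), and let E′ : ℕ⁺ → ℝ be the output of the bank of per-flow minimal regulators, defined for each flow f by letting (E′^f) be the minimal Π^f-regulator output for the input (D^f, L^f) (i.e., E′^f_1 = D^f_1 and E′^f_i = max{D^f_i, E′^f_{i−1}, Π^f(E′^f, L^f)_i} for i ≥ 2). Then E_n ≥ E′_n for all n ∈ ℕ⁺; that is, the minimal interleaved regulator never releases a packet earlier than the corresponding per-flow minimal regulator. -/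
/-- the minimal interleaved regulator never releases a packet earlier than
the corresponding bank of per-flow minimal regulators: if `E` is the minimal interleaved
regulator output for input `(D, L, F)` and `E'` is such that, for every flow `f`, the
subsequence `E'^f` is the minimal `Π^f`-regulator output for input `(D^f, L^f)`, then
`E'_n ≤ E_n` for all `n`. -/
theorem minIR_ge_perFlow {𝔽 : Type} [Fintype 𝔽] [DecidableEq 𝔽]
    (P : 𝔽 → RegOp) (hC : ∀ f, Causal (P f)) (hH : ∀ f, Homogeneous (P f))
    (hI : ∀ f, IsotoneOp (P f))
    (A : ℕ → ℝ) (L : ℕ → ℕ+) (F : ℕ → 𝔽) (hA : Monotone A)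
    (hinf : ∀ f : 𝔽, {n : ℕ | F n = f}.Infinite)
    (D : ℕ → ℝ) (hDmono : Monotone D) (hAD : ∀ n, A n ≤ D n)
    (E : ℕ → ℝ) (hE : IRRec P D L F E)
    (E' : ℕ → ℝ)
    (hE' : ∀ f : 𝔽, MinRegRec (P f) (subSeq F f D) (subSeq F f L) (subSeq F f E')) :
    ∀ n : ℕ, E' n ≤ E n := by
  have hEm : Monotone E := monotone_nat_of_le_succ fun n => by
    have h := hE.2 n
    have : ((E n : ℝ) : WithBot ℝ) ≤ ((E (n + 1) : ℝ) : WithBot ℝ) := by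
      rw [h]; exact le_sup_of_le_left le_sup_right
    exact WithBot.coe_le_coe.1 this
  have hDE : ∀ n, D n ≤ E n := by
    intro n
    cases n with
    | zero => exact hE.1.ge
    | succ n =>
      have h := hE.2 n
      have : ((D (n + 1) : ℝ) : WithBot ℝ) ≤ ((E (n + 1) : ℝ) : WithBot ℝ) := by
        rw [h]; exact le_sup_of_le_left le_sup_left
      exact WithBot.coe_le_coe.1 this
  have hE'm : ∀ f, Monotone (subSeq F f E') := fun f => monotone_nat_of_le_succ fun n => by
    have h := (hE' f).2 n
    have : ((subSeq F f E' n : ℝ) : WithBot ℝ) ≤ ((subSeq F f E' (n + 1) : ℝ) : WithBot ℝ) := by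
      rw [h]; exact le_sup_of_le_left le_sup_right
    exact WithBot.coe_le_coe.1 this
  have hEfm : ∀ f, Monotone (subSeq F f E) := fun f =>
    hEm.comp (Nat.nth_strictMono (p := fun n => F n = f) (hinf f)).monotone
  intro n
  induction n using Nat.strong_induction_on with
  | _ n ih =>
  have hnth : Nat.nth (fun m => F m = F n) (flowIdx F n) = n :=
    Nat.nth_count (p := fun m => F m = F n) rfl
  have key : ∀ {X : ℕ → ℝ}, subSeq F (F n) X (flowIdx F n) = X n := by
    intro X
    simp only [subSeq, hnth]
  have hlt : ∀ k, k < flowIdx F n → Nat.nth (fun m => F m = F n) k < n := by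
    intro k hk
    have := Nat.nth_strictMono (p := fun m => F m = F n) (hinf (F n)) hk
    rwa [hnth] at this
  have ihk : ∀ k, k < flowIdx F n → subSeq F (F n) E' k ≤ subSeq F (F n) E k :=
    fun k hk => ih _ (hlt k hk)
  rcases hi : flowIdx F n with _ | j
  · have h := (hE' (F n)).1
    rw [← hi, key, key] at h
    rw [h]; exact hDE n
  · have h := (hE' (F n)).2 j
    rw [← hi, key, key] at h
    rw [← WithBot.coe_le_coe, h]
    have hj : j < flowIdx F n := by omega
    refine sup_le (sup_le (WithBot.coe_le_coe.2 (hDE n)) (WithBot.coe_le_coe.2 ?_)) ?_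
    · exact (ihk j hj).trans (hEm (hlt j hj).le)
    · have hBm : Monotone (fun k => min (subSeq F (F n) E' k) (subSeq F (F n) E k)) :=
        (hE'm (F n)).min (hEfm (F n))
      rw [hC (F n) _ _ _ (subSeq F (F n) L) (hE'm (F n)) hBm (flowIdx F n)
        (fun m hm => (min_eq_left (ihk m hm)).symm) (fun _ _ => rfl)]
      refine (hI (F n) _ _ _ hBm (hEfm (F n)) (fun k => min_le_right _ _) _).trans ?_
      cases n with
      | zero => simp [flowIdx] at hi
      | succ n => rw [hE.2 n]; exact le_sup_right
end

section
/- Let r > 0 and b > 0, and let σ be the leaky bucket arrival curve: σ(0) = 0 and σ(t) = rt + b for t > 0. Let (A, L) be a single-flow packet sequence with A : ℕ⁺ → [0,∞) wide-sense increasing and L : ℕ⁺ → ℕ⁺, and let R be its cumulative arrival function. Then the flow satisfies the arrival curve constraint σ — i.e., R(t) ≤ R(s) + σ(t−s) for all 0 ≤ s ≤ t — if and only if for all m, n ∈ ℕ⁺ with m ≤ n: A_n − A_m ≥ max(0, ((Σ_{j=m}^{n} L_j) − b)/r). -/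
open scoped NNReal ENNReal

/-- The leaky bucket arrival curve `σ(0) = 0`, `σ(t) = r·t + b` for `t > 0`. -/
noncomputable def leakyBucket (r b : ℝ≥0) (t : ℝ≥0) : ℝ≥0 :=
  if t = 0 then 0 else r * t + b

/-- a flow satisfies the leaky bucket arrival curve constraint LB(r, b)
if and only if `A_n - A_m ≥ max(0, ((Σ_{j=m}^{n} L_j) - b)/r)` for all `m ≤ n`. -/
theorem leakyBucket_iff_packetTimes (r b : ℝ≥0) (hr : 0 < r) (hb : 0 < b)
    (A : ℕ → ℝ≥0) (L : ℕ → ℕ+) (hA : Monotone A) :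
    (∀ s t : ℝ≥0, s ≤ t →
        cumArrival A L t ≤ cumArrival A L s + (leakyBucket r b (t - s) : ℝ≥0∞)) ↔
      (∀ m n : ℕ, m ≤ n →
        max 0 (((∑ j ∈ Finset.Icc m n, ((L j : ℕ) : ℝ)) - (b : ℝ)) / (r : ℝ))
          ≤ (A n : ℝ) - (A m : ℝ)) := by
  have hr' : (0 : ℝ) < r := by exact_mod_cast hr
  constructor
  · intro h m n hmn
    have hAmn : A m ≤ A n := hA hmn
    have hAmn' : (A m : ℝ) ≤ A n := by exact_mod_cast hAmn
    have hfin : cumArrival A L (A m) ≠ ⊤ := by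
      unfold cumArrival
      rw [tsum_eq_sum (s := Finset.range m)]
      · refine (ENNReal.sum_lt_top.2 fun i _ => ?_).ne
        split_ifs
        · exact ENNReal.natCast_lt_top _
        · simp
      · intro i hi
        have : m ≤ i := by simpa using hi
        rw [if_neg (not_lt.2 (hA this))]
    refine max_le (by linarith) ?_
    rw [div_le_iff₀ hr']
    have key : ∀ e : ℝ≥0, 0 < e →
        (∑ j ∈ Finset.Icc m n, ((L j : ℕ) : ℝ≥0)) ≤ r * (A n + e - A m) + b := by
      intro e he
      have hlt : A m < A n + e := lt_of_le_of_lt hAmn (lt_add_of_pos_right _ he)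
      have h1 := h (A m) (A n + e) hlt.le
      have h2 : cumArrival A L (A m) + ((∑ j ∈ Finset.Icc m n, ((L j : ℕ) : ℝ≥0) : ℝ≥0) : ℝ≥0∞)
          ≤ cumArrival A L (A n + e) := by
        have h3 : ((∑ j ∈ Finset.Icc m n, ((L j : ℕ) : ℝ≥0) : ℝ≥0) : ℝ≥0∞) =
            ∑' j : ℕ, if j ∈ Finset.Icc m n then ((L j : ℕ) : ℝ≥0∞) else 0 := by
          rw [tsum_eq_sum (s := Finset.Icc m n)]
          · push_cast
            exact Finset.sum_congr rfl fun j hj => by rw [if_pos hj]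
          · intro j hj
            rw [if_neg hj]
        rw [h3]
        unfold cumArrival
        rw [← ENNReal.tsum_add]
        refine ENNReal.tsum_le_tsum fun j => ?_
        by_cases hj : j ∈ Finset.Icc m n
        · have hj' := Finset.mem_Icc.1 hj
          rw [if_neg (not_lt.2 (hA hj'.1)), if_pos hj,
            if_pos (lt_of_le_of_lt (hA hj'.2) (lt_add_of_pos_right _ he))]
          simp
        · rw [if_neg hj, add_zero]
          by_cases hs : A j < A m
          · rw [if_pos hs, if_pos (hs.trans hlt)]
          · rw [if_neg hs]
            exact zero_le
      have h4 := (ENNReal.add_le_add_iff_left hfin).1 (h2.trans h1)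
      have h5 := ENNReal.coe_le_coe.1 h4
      unfold leakyBucket at h5
      rwa [if_neg (tsub_pos_of_lt hlt).ne'] at h5
    refine le_of_forall_pos_le_add fun e he => ?_
    lift e to ℝ≥0 using he.le
    have he' : 0 < e := by exact_mod_cast he
    have hk := key (e / r) (div_pos he' hr)
    have hk' := NNReal.coe_le_coe.2 hk
    rw [NNReal.coe_add, NNReal.coe_mul, NNReal.coe_sub (hAmn.trans le_self_add)] at hk'
    push_cast at hk'
    have : (r : ℝ) * ((e : ℝ) / r) = e := by field_simp
    linarith
  · intro h s t hst
    rcases hst.eq_or_lt with rfl | hlt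
    · exact le_self_add
    have hσ : leakyBucket r b (t - s) = r * (t - s) + b := by
      unfold leakyBucket
      rw [if_neg (tsub_pos_of_lt hlt).ne']
    have hsplit : cumArrival A L t ≤ cumArrival A L s +
        ∑' j : ℕ, if s ≤ A j ∧ A j < t then ((L j : ℕ) : ℝ≥0∞) else 0 := by
      unfold cumArrival
      rw [← ENNReal.tsum_add]
      refine ENNReal.tsum_le_tsum fun j => ?_
      by_cases h1 : A j < s
      · rw [if_pos h1, if_pos (h1.trans hlt)]
        exact le_self_add
      · simp [h1, not_lt.1 h1]
    refine hsplit.trans (add_le_add_right ?_ _)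
    rw [ENNReal.tsum_eq_iSup_sum]
    refine iSup_le fun F => ?_
    rw [← Finset.sum_filter]
    set G := F.filter fun j => s ≤ A j ∧ A j < t with hG
    rcases G.eq_empty_or_nonempty with hE | hne
    · rw [hE]; simp
    have hm := G.min'_mem hne
    have hn := G.max'_mem hne
    set m := G.min' hne
    set n := G.max' hne
    have hsub : G ⊆ Finset.Icc m n := fun j hj =>
      Finset.mem_Icc.2 ⟨G.min'_le j hj, G.le_max' j hj⟩
    have hms := (Finset.mem_filter.1 hm).2.1
    have hnt := (Finset.mem_filter.1 hn).2.2
    have hmn : m ≤ n := G.min'_le _ hn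
    have hk := (le_max_right _ _).trans (h m n hmn)
    rw [div_le_iff₀ hr'] at hk
    refine (Finset.sum_le_sum_of_subset hsub).trans ?_
    have : (∑ j ∈ Finset.Icc m n, ((L j : ℕ) : ℝ≥0)) ≤ leakyBucket r b (t - s) := by
      rw [hσ, ← NNReal.coe_le_coe, NNReal.coe_add, NNReal.coe_mul, NNReal.coe_sub hst]
      push_cast
      have h1 : (s : ℝ) ≤ A m := by exact_mod_cast hms
      have h2 : (A n : ℝ) ≤ t := by exact_mod_cast hnt.le
      nlinarith [mul_le_mul_of_nonneg_left (show (A n : ℝ) - A m ≤ t - s by linarith) hr'.le]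
    have h6 := ENNReal.coe_le_coe.2 this
    push_cast at h6
    exact h6
end

section
/- Let τ > 0 and b > 0 and let σ be the staircase function σ(t) = b·⌈t/τ⌉ for t ≥ 0. Then the right-limit function of σ satisfies σ⁺(t) = b·⌊t/τ + 1⌋ for all t ≥ 0, and the lower pseudo-inverse of σ satisfies σ↓(x) = τ·⌈x/b − 1⌉ for all x > 0 and σ↓(0) = 0. -/
open scoped NNReal ENNReal

/-- The staircase function `σ(t) = b·⌈t/τ⌉`. -/
noncomputable def staircase (τ b : ℝ≥0) (t : ℝ≥0) : ℝ≥0 :=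
  b * (⌈t / τ⌉₊ : ℝ≥0)

/-- for the staircase function `σ(t) = b·⌈t/τ⌉` with `τ, b > 0`, the
right-limit function is `σ⁺(t) = b·⌊t/τ + 1⌋`, and the lower pseudo-inverse is
`σ↓(x) = τ·⌈x/b − 1⌉` for `x > 0` and `σ↓(0) = 0`. -/
theorem staircase_rightLim_and_lowerPseudoInv (τ b : ℝ≥0) (hτ : 0 < τ) (hb : 0 < b) :
    (∀ t : ℝ≥0, rightLim' (staircase τ b) t = b * (⌊t / τ + 1⌋₊ : ℝ≥0)) ∧
    (∀ x : ℝ≥0, 0 < x →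
      lowerPseudoInv (staircase τ b) x =
        ENNReal.ofReal ((τ : ℝ) * (⌈(x : ℝ) / (b : ℝ) - 1⌉ : ℤ))) ∧
    lowerPseudoInv (staircase τ b) 0 = 0 := by
  refine ⟨fun t => ?_, fun x hx => ?_, ?_⟩
  · have hfl : ⌊t / τ + 1⌋₊ = ⌊t / τ⌋₊ + 1 := Nat.floor_add_one (zero_le)
    rw [hfl]
    unfold rightLim' staircase
    have hlt : t < τ * ((⌊t / τ⌋₊ + 1 : ℕ) : ℝ≥0) := by
      have := Nat.lt_floor_add_one (t / τ)
      rw [div_lt_iff₀ hτ] at this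
      push_cast
      rwa [mul_comm]
    haveI : Nonempty {s : ℝ≥0 // t < s} := ⟨⟨_, hlt⟩⟩
    apply le_antisymm
    · refine (ciInf_le (OrderBot.bddBelow _) (⟨_, hlt⟩ : {s : ℝ≥0 // t < s})).trans ?_
      simp only
      rw [mul_div_cancel_left₀ _ hτ.ne', Nat.ceil_natCast]
    · refine le_ciInf fun s => ?_
      have h1 : ⌊t / τ⌋₊ < ⌈(s : ℝ≥0) / τ⌉₊ := by
        rw [Nat.lt_ceil]
        refine (Nat.floor_le (zero_le)).trans_lt ?_
        rw [div_lt_div_iff_of_pos_right hτ]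
        exact s.2
      have h2 : ((⌊t / τ⌋₊ + 1 : ℕ) : ℝ≥0) ≤ (⌈(s : ℝ≥0) / τ⌉₊ : ℝ≥0) := by
        exact_mod_cast h1
      exact mul_le_mul_right h2 b
  · obtain ⟨m, hm⟩ : ∃ m, ⌈x / b⌉₊ = m + 1 :=
      Nat.exists_eq_succ_of_ne_zero (Nat.ceil_pos.2 (div_pos hx hb)).ne'
    have hc : ⌈(x : ℝ) / (b : ℝ) - 1⌉ = (m : ℤ) := by
      have h := (Nat.ceil_eq_iff (Nat.succ_ne_zero m)).1 hm
      have h1 : ((m + 1 - 1 : ℕ) : ℝ) < (x : ℝ) / b := by exact_mod_cast h.1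
      have h2 : (x : ℝ) / b ≤ ((m + 1 : ℕ) : ℝ) := by exact_mod_cast h.2
      rw [Nat.add_sub_cancel] at h1
      push_cast at h2
      rw [Int.ceil_eq_iff]
      push_cast
      constructor <;> linarith
    have hr : ENNReal.ofReal ((τ : ℝ) * ((m : ℤ) : ℝ)) = ((τ * (m : ℝ≥0) : ℝ≥0) : ℝ≥0∞) := by
      rw [← ENNReal.ofReal_coe_nnreal]
      push_cast
      rfl
    rw [hc, hr]
    have key : ∀ s : ℝ≥0, x ≤ staircase τ b s ↔ τ * (m : ℝ≥0) < s := by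
      intro s
      unfold staircase
      rw [mul_comm b, ← div_le_iff₀ hb, ← Nat.ceil_le, hm, Nat.succ_le_iff, Nat.lt_ceil,
        lt_div_iff₀ hτ, mul_comm]
    unfold lowerPseudoInv
    apply le_antisymm
    · refine ENNReal.le_of_forall_pos_le_add fun ε hε _ => ?_
      have hs : τ * (m : ℝ≥0) < τ * (m : ℝ≥0) + ε := lt_add_of_pos_right _ hε
      refine (iInf_le _ (⟨_, (key _).2 hs⟩ : {s : ℝ≥0 // x ≤ staircase τ b s})).trans ?_
      simp
    · refine le_iInf fun s => ?_
      exact_mod_cast ((key _).1 s.2).le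
  · unfold lowerPseudoInv
    refine le_antisymm ?_ (zero_le)
    refine (iInf_le _ (⟨0, zero_le⟩ : {s : ℝ≥0 // 0 ≤ staircase τ b s})).trans ?_
    simp
end

section
/- Let τ > 0, let K, ℓ ∈ ℕ⁺, and let (A, L) be a single-flow packet sequence with A : ℕ⁺ → [0,∞) wide-sense increasing and all packets of the same length L_n = ℓ; let R be its cumulative arrival function. Then the flow satisfies the arrival curve constraint with the staircase curve σ(t) = Kℓ·⌈t/τ⌉ — i.e., R(t) ≤ R(s) + σ(t−s) for all 0 ≤ s ≤ t — if and only if for all m, n ∈ ℕ⁺ with m ≤ n: A_n − A_m ≥ τ·⌈(n − m + 1 − K)/K⌉. (This is the 'TSN packet rate regulation' rule: at most K packets in any window of duration τ.) -/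
open scoped NNReal ENNReal

theorem cum_lo (ℓ : ℕ+) (A : ℕ → ℝ≥0) (L : ℕ → ℕ+) (hL : ∀ n, L n = ℓ) (t : ℝ≥0) (N : ℕ)
    (h : ∀ i < N, A i < t) : ((N * (ℓ : ℕ) : ℕ) : ℝ≥0∞) ≤ cumArrival A L t := by
  unfold cumArrival
  refine le_trans (le_of_eq ?_) (ENNReal.sum_le_tsum (Finset.range N))
  rw [Finset.sum_congr rfl (g := fun _ => ((ℓ : ℕ) : ℝ≥0∞))]
  · simp
  · intro i hi
    rw [if_pos (h i (Finset.mem_range.1 hi)), hL]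

theorem cum_hi (ℓ : ℕ+) (A : ℕ → ℝ≥0) (L : ℕ → ℕ+) (hL : ∀ n, L n = ℓ) (t : ℝ≥0) (N : ℕ)
    (h : ∀ i, N ≤ i → t ≤ A i) : cumArrival A L t ≤ ((N * (ℓ : ℕ) : ℕ) : ℝ≥0∞) := by
  unfold cumArrival
  rw [tsum_eq_sum (s := Finset.range N)]
  · refine le_trans (Finset.sum_le_sum (g := fun _ => ((ℓ : ℕ) : ℝ≥0∞)) ?_) (le_of_eq (by simp))
    intro i _
    split_ifs
    · rw [hL]
    · exact zero_le
  · intro i hi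
    rw [if_neg (not_lt.2 (h i (by simpa using hi)))]

theorem tsn_packetRate_iff (τ : ℝ≥0) (hτ : 0 < τ) (K ℓ : ℕ+)
    (A : ℕ → ℝ≥0) (L : ℕ → ℕ+) (hA : Monotone A) (hL : ∀ n, L n = ℓ) :
    (∀ s t : ℝ≥0, s ≤ t →
        cumArrival A L t ≤ cumArrival A L s +
          (((K : ℕ) * (ℓ : ℕ) : ℕ) : ℝ≥0∞) * (⌈(t - s) / τ⌉₊ : ℝ≥0∞)) ↔
      (∀ m n : ℕ, m ≤ n →
        (τ : ℝ) * (⌈((n : ℝ) - (m : ℝ) + 1 - (K : ℕ)) / ((K : ℕ) : ℝ)⌉ : ℤ)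
          ≤ (A n : ℝ) - (A m : ℝ)) := by
  have hK : (0 : ℝ) < ((K : ℕ) : ℝ) := by exact_mod_cast K.pos
  have hτ' : (0 : ℝ) < (τ : ℝ) := by exact_mod_cast hτ
  constructor
  · intro H m n hmn
    by_contra hcon
    push Not at hcon
    have hAmn : (A m : ℝ) ≤ A n := by exact_mod_cast hA hmn
    have hc0 : 0 < ⌈((n : ℝ) - (m : ℝ) + 1 - (K : ℕ)) / ((K : ℕ) : ℝ)⌉ := by
      by_contra h0
      push Not at h0
      have : ((⌈((n : ℝ) - (m : ℝ) + 1 - (K : ℕ)) / ((K : ℕ) : ℝ)⌉ : ℤ) : ℝ) ≤ 0 := by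
        exact_mod_cast h0
      nlinarith
    obtain ⟨c, hc⟩ := Int.eq_ofNat_of_zero_le hc0.le
    rw [hc] at hcon
    have h1 := H (A m) (A m + τ * c) le_self_add
    have h2 : (A m + τ * c - A m) / τ = (c : ℝ≥0) := by
      rw [add_tsub_cancel_left, mul_div_cancel_left₀ _ hτ.ne']
    rw [h2, Nat.ceil_natCast] at h1
    have hn : A n < A m + τ * c := by
      rw [← NNReal.coe_lt_coe]; push_cast; push_cast at hcon; linarith
    have h3 := cum_lo ℓ A L hL (A m + τ * c) (n+1)
      (fun i hi => (hA (by omega)).trans_lt hn)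
    have h4 := cum_hi ℓ A L hL (A m) m (fun i hi => hA hi)
    have h5 := (h3.trans h1).trans (add_le_add_left h4 _)
    have h6 : (n+1) * (ℓ:ℕ) ≤ m * (ℓ:ℕ) + (K:ℕ) * ℓ * c := by exact_mod_cast h5
    have h7 : n + 1 ≤ m + (K:ℕ) * c := by
      refine Nat.le_of_mul_le_mul_right ?_ ℓ.pos
      linarith
    have h8 : ((c:ℤ):ℝ) < ((n : ℝ) - (m : ℝ) + 1 - (K : ℕ)) / ((K : ℕ) : ℝ) + 1 := by
      have := Int.ceil_lt_add_one (((n : ℝ) - (m : ℝ) + 1 - (K : ℕ)) / ((K : ℕ) : ℝ))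
      rw [hc] at this
      exact this
    have h9 : (c - 1 : ℤ) < ⌈((n : ℝ) - (m : ℝ) + 1 - (K : ℕ)) / ((K : ℕ) : ℝ)⌉ := by
      rw [hc]; simp
    have h7' : (n:ℝ) + 1 ≤ m + (K:ℕ) * c := by exact_mod_cast h7
    have h10 : ⌈((n : ℝ) - (m : ℝ) + 1 - (K : ℕ)) / ((K : ℕ) : ℝ)⌉ ≤ (c:ℤ) - 1 := by
      rw [Int.ceil_le, div_le_iff₀ hK]
      push_cast
      linarith
    omega
  · intro H s t hst
    by_cases hex : ∃ m, s ≤ A m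
    · classical
      have hm := Nat.find_spec hex
      have hmin : ∀ i < Nat.find hex, A i < s := fun i hi => not_le.1 (Nat.find_min hex hi)
      generalize Nat.find hex = m at hm hmin
      have hlo := cum_lo ℓ A L hL s m hmin
      set c := ⌈(t - s) / τ⌉₊ with hc
      have hcr : t - s ≤ c * τ := by
        rw [← div_le_iff₀ hτ]; exact Nat.le_ceil _
      have h1 := H m (m + K * c) (by omega)
      have h2 : (c : ℤ) ≤ ⌈(((m + K * c : ℕ) : ℝ) - (m : ℝ) + 1 - (K : ℕ)) / ((K : ℕ) : ℝ)⌉ := by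
        rw [← Int.sub_one_lt_iff, Int.lt_ceil, lt_div_iff₀ hK]
        push_cast
        linarith
      have h3 : (c:ℝ) ≤ ((⌈(((m + K * c : ℕ) : ℝ) - (m : ℝ) + 1 - (K : ℕ)) / ((K : ℕ) : ℝ)⌉ : ℤ) : ℝ) := by
        exact_mod_cast h2
      have h4 := mul_le_mul_of_nonneg_left h3 hτ'.le
      have h5 : t ≤ A (m + K * c) := by
        have h6 : t ≤ c * τ + s := tsub_le_iff_right.1 hcr
        have h6' : (t:ℝ) ≤ c * τ + s := by exact_mod_cast h6
        have hm' : (s:ℝ) ≤ A m := by exact_mod_cast hm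
        rw [← NNReal.coe_le_coe]
        linarith
      refine (cum_hi ℓ A L hL t (m + K * c) (fun i hi => h5.trans (hA hi))).trans ?_
      refine le_trans (le_of_eq ?_) (add_le_add_left hlo _)
      push_cast
      ring
    · push Not at hex
      refine le_trans (le_of_eq ?_) le_self_add
      unfold cumArrival
      refine tsum_congr fun n => ?_
      rw [if_pos (hex n), if_pos ((hex n).trans_le hst)]
end

section
/- Let ρ > 0 and K ∈ ℕ⁺, and let A : ℕ⁺ → [0,∞) be a wide-sense increasing sequence of packet arrival dates. Define the packet counting function N(t) = Σ_{n∈ℕ⁺} 1{A_n < t} for t ≥ 0 (with values in [0,∞]). Then the packet burstiness constraint PB(ρ, K) holds — i.e., N(t) ≤ N(s) + ρ(t−s) + K for all 0 ≤ s < t — if and only if for all m, n ∈ ℕ⁺ with m ≤ n − 1: A_n − A_m ≥ (n − m + 1 − K)/ρ. -/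
open scoped NNReal ENNReal

/-- Packet counting function `N(t) = Σ_{n} 1{A_n < t}` (packets indexed from `0`). -/
noncomputable def packetCount (A : ℕ → ℝ≥0) (t : ℝ≥0) : ℝ≥0∞ :=
  ∑' n : ℕ, if A n < t then (1 : ℝ≥0∞) else 0

theorem pc_le (A : ℕ → ℝ≥0) (t : ℝ≥0) (c : ℝ≥0∞)
    (h : ∀ n : ℕ, A n < t → ((n + 1 : ℕ) : ℝ≥0∞) ≤ c) : packetCount A t ≤ c := by
  unfold packetCount
  apply ENNReal.tsum_le_of_sum_range_le
  intro n
  induction n with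
  | zero => simp
  | succ n ih =>
    by_cases hn : A n < t
    · refine le_trans ?_ (h n hn)
      calc _ ≤ ∑ i ∈ Finset.range (n + 1), (1 : ℝ≥0∞) := by
            apply Finset.sum_le_sum
            intro i _
            split_ifs <;> simp
        _ = _ := by simp
    · rw [Finset.sum_range_succ, if_neg hn, add_zero]
      exact ih

theorem le_pc (A : ℕ → ℝ≥0) (hA : Monotone A) (t : ℝ≥0) (n : ℕ) (h : A n < t) :
    ((n + 1 : ℕ) : ℝ≥0∞) ≤ packetCount A t := by
  unfold packetCount
  refine le_trans ?_ (ENNReal.sum_le_tsum (Finset.range (n + 1)))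
  rw [Finset.sum_congr rfl (g := fun _ => (1 : ℝ≥0∞))]
  · simp
  · intro i hi
    rw [if_pos]
    exact lt_of_le_of_lt (hA (Nat.lt_succ_iff.mp (Finset.mem_range.mp hi))) h

/-- the packet burstiness constraint PB(ρ, K) — at most `ρt + K` packets
in any interval of duration `t` — holds if and only if
`A_n - A_m ≥ (n - m + 1 - K)/ρ` for all `m < n` (packets indexed from `0`,
so `n - m + 1` is the number of packets from `m` to `n`). -/
theorem packetBurstiness_iff (ρ : ℝ≥0) (hρ : 0 < ρ) (K : ℕ+)
    (A : ℕ → ℝ≥0) (hA : Monotone A) :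
    (∀ s t : ℝ≥0, s < t →
        packetCount A t ≤ packetCount A s + ((ρ * (t - s) + (K : ℕ) : ℝ≥0) : ℝ≥0∞)) ↔
      (∀ m n : ℕ, m < n →
        ((n : ℝ) - (m : ℝ) + 1 - ((K : ℕ) : ℝ)) / (ρ : ℝ)
          ≤ (A n : ℝ) - (A m : ℝ)) := by
  have hρ' : (0 : ℝ) < ρ := hρ
  have hK : (1 : ℝ) ≤ ((K : ℕ) : ℝ) := by exact_mod_cast K.pos
  constructor
  · intro H m n hmn
    rw [div_le_iff₀ hρ']
    have hle : A m ≤ A n := hA hmn.le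
    apply le_of_forall_pos_le_add
    intro e he
    set d : ℝ≥0 := ⟨e / ρ, by positivity⟩ with hd
    have hdr : (d : ℝ) = e / ρ := rfl
    have hd0 : 0 < d := by
      rw [← NNReal.coe_pos, hdr]
      positivity
    have hlt : A n < A n + d := lt_add_of_pos_right _ hd0
    have h1 := H (A m) (A n + d) (lt_of_le_of_lt hle hlt)
    have h2 := le_pc A hA _ n hlt
    have h3 : packetCount A (A m) ≤ (m : ℝ≥0∞) := by
      apply pc_le
      intro k hk
      have : k < m := hA.reflect_lt hk
      exact_mod_cast this
    have h4 := h2.trans (h1.trans (add_le_add_left h3 _))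
    have h5 : ((n + 1 : ℕ) : ℝ≥0) ≤ (m : ℝ≥0) + (ρ * (A n + d - A m) + (K : ℕ)) := by
      exact_mod_cast h4
    rw [← NNReal.coe_le_coe] at h5
    push_cast [NNReal.coe_sub (hle.trans hlt.le)] at h5
    rw [hdr] at h5
    have h6 : (ρ : ℝ) * (A n + e / ρ - A m) = (A n - A m) * ρ + e := by
      field_simp
      ring
    rw [h6] at h5
    linarith
  · intro H s t hst
    by_cases hs : ∃ m, s ≤ A m
    · have hm := Nat.find_spec hs
      have hmin := fun k => Nat.find_min hs (m := k)
      set m := Nat.find hs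
      have h1 : (m : ℝ≥0∞) ≤ packetCount A s := by
        rcases Nat.eq_zero_or_pos m with h0 | h0
        · rw [h0]; simp
        · have := le_pc A hA s (m - 1) (not_le.mp (hmin (m - 1) (by omega)))
          rwa [Nat.sub_add_cancel h0] at this
      refine le_trans ?_ (add_le_add_left h1 _)
      apply pc_le
      intro n hn
      have h5 : ((n + 1 : ℕ) : ℝ≥0) ≤ (m : ℝ≥0) + (ρ * (t - s) + (K : ℕ)) := by
        rw [← NNReal.coe_le_coe]
        push_cast [NNReal.coe_sub hst.le]
        have hst' : (s : ℝ) < t := hst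
        have hm' : (s : ℝ) ≤ A m := hm
        have hn' : (A n : ℝ) < t := hn
        rcases le_or_gt n m with hnm | hnm
        · have : (n : ℝ) ≤ m := by exact_mod_cast hnm
          have : 0 ≤ (ρ : ℝ) * (t - s) := mul_nonneg hρ'.le (by linarith)
          linarith
        · have h := H m n hnm
          rw [div_le_iff₀ hρ'] at h
          have : ((A n : ℝ) - A m) * ρ ≤ (t - s) * ρ :=
            mul_le_mul_of_nonneg_right (by linarith) hρ'.le
          linarith
      exact_mod_cast h5
    · push Not at hs
      have : packetCount A s = ⊤ := by
        by_contra hne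
        obtain ⟨n, hn⟩ := ENNReal.exists_nat_gt hne
        have h := le_pc A hA s n (hs n)
        have h2 := lt_of_le_of_lt h hn
        have h3 : n + 1 < n := by exact_mod_cast h2
        omega
      rw [this]
      simp
end
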